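/- arXiv:math/0508351 — 2 statements merged into one kernel-verified Lean document; each statement's English description precedes it below -/
import Mathlib

section
/- The number of quandle structures on a set of 7 elements (equivalently, the number of 7 × 7 standard form quandle matrices) is 152900: there are exactly 152900 binary operations ▷ on {1,…,7} satisfying the three quandle axioms. -/
/-- A binary operation is a quandle operation if it satisfies the three quandle axioms. -/
def IsQuandleOp {Q : Type*} (op : Q → Q → Q) : Prop :=
  (∀ x, op x x = x) ∧
  (∀ x y, ∃! z, x = op z y) ∧
  (∀ x y z, op (op x y) z = op (op x z) (op y z))

noncomputable section
/-- A seven-element type on which the kernel evaluates case distinctions quickly. -/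
inductive Pt where
  | p0 | p1 | p2 | p3 | p4 | p5 | p6
  deriving DecidableEq

namespace Pt

instance : Fintype Pt where
  elems := {p0, p1, p2, p3, p4, p5, p6}
  complete x := by cases x <;> simp

/-- Boolean equality test. -/
def beq (a b : Pt) : Bool :=
  Pt.rec
    (Pt.rec true false false false false false false b)
    (Pt.rec false true false false false false false b)
    (Pt.rec false false true false false false false b)
    (Pt.rec false false false true false false false b)
    (Pt.rec false false false false true false false b)
    (Pt.rec false false false false false true false b)
    (Pt.rec false false false false false false true b) a

/-- Evaluate `x` before passing it to `k`. -/
def force {α : Type} (x : Pt) (k : Pt → α) : α :=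
  Pt.rec (k p0) (k p1) (k p2) (k p3) (k p4) (k p5) (k p6) x

/-- Whether a Boolean predicate holds everywhere. -/
def all (f : Pt → Bool) : Bool :=
  cond (f p0) (cond (f p1) (cond (f p2) (cond (f p3) (cond (f p4) (cond (f p5) (f p6)
    false) false) false) false) false) false

/-- The number of points at which a Boolean predicate holds. -/
def count (f : Pt → Bool) : ℕ :=
  List.rec Nat.zero (fun a _ ih => cond (f a) (Nat.succ ih) ih) [p0, p1, p2, p3, p4, p5, p6]

/-- An invariant of the cycle type of a permutation. -/
def key (f : Pt → Pt) : ℕ :=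
  Nat.add (Nat.mul 8 (count fun x => (f (f x)).beq x)) (count fun x => (f x).beq x)

/-- Membership of a point in a list. -/
def mem (x : Pt) (l : List Pt) : Bool :=
  List.rec false (fun a _ ih => cond (beq x a) true ih) l

end Pt

/-- Families indexed by `Pt`, stored as tuples. -/
structure Vec7 (α : Type) where
  (x0 x1 x2 x3 x4 x5 x6 : α)

namespace Vec7

variable {α : Type}

/-- The entry at a given index. -/
def get (v : Vec7 α) (i : Pt) : α :=
  Vec7.rec (fun x0 x1 x2 x3 x4 x5 x6 => Pt.rec x0 x1 x2 x3 x4 x5 x6 i) v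

/-- The tuple of values of a function. -/
def ofFn (f : Pt → α) : Vec7 α :=
  ⟨f .p0, f .p1, f .p2, f .p3, f .p4, f .p5, f .p6⟩

/-- Evaluate `v` to a tuple before passing it to `k`. -/
def force {β : Type} (v : Vec7 α) (k : Vec7 α → β) : β :=
  Vec7.rec (fun x0 x1 x2 x3 x4 x5 x6 => k ⟨x0, x1, x2, x3, x4, x5, x6⟩) v

/-- Replace the entry at a given index. -/
def set (v : Vec7 α) (i : Pt) (y : α) : Vec7 α :=
  Vec7.rec (fun x0 x1 x2 x3 x4 x5 x6 =>
    Pt.rec ⟨y, x1, x2, x3, x4, x5, x6⟩ ⟨x0, y, x2, x3, x4, x5, x6⟩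
      ⟨x0, x1, y, x3, x4, x5, x6⟩ ⟨x0, x1, x2, y, x4, x5, x6⟩ ⟨x0, x1, x2, x3, y, x5, x6⟩
      ⟨x0, x1, x2, x3, x4, y, x6⟩ ⟨x0, x1, x2, x3, x4, x5, y⟩ i) v

end Vec7

/-- A self-map of `Pt`, thought of as a column of an operation table. -/
abbrev Col := Vec7 Pt

/-- An operation table, stored by columns. -/
abbrev Tab := Vec7 Col

namespace Col

/-- An invariant of the cycle type of a permutation. -/
def key (p : Col) : ℕ := Pt.key p.get

/-- Whether a column is an injective map. -/
def inj (p : Col) : Bool :=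
  Pt.all fun x => Pt.all fun y => cond (x.beq y) true
    (cond ((p.get x).beq (p.get y)) false true)

/-- Whether `b ∘ q = q ∘ a`. -/
def intertwines (b q a : Col) : Bool :=
  b.force fun b => q.force fun q => a.force fun a =>
    Pt.all fun x => (b.get (q.get x)).beq (q.get (a.get x))

/-- The column `c` with `c ∘ q = q ∘ a`, when `q` is bijective. -/
def conj (q a : Col) : Col :=
  List.rec ⟨.p0, .p0, .p0, .p0, .p0, .p0, .p0⟩
    (fun x _ ih => (q.get x).force fun i => (q.get (a.get x)).force fun y => ih.set i y)
    [Pt.p0, .p1, .p2, .p3, .p4, .p5, .p6]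

end Col

/-- Prepend to `acc` the lists `k a`, for all `a` not in `l` that may be the image of `x` under a
permutation fixing `y`. -/
def choices (y x : Pt) (l : List Pt) (k : Pt → List Col → List Col) (acc : List Col) : List Col :=
  List.rec acc (fun a _ ih => cond (a.mem l) ih (k a ih))
    (cond (x.beq y) [y] (List.rec [] (fun a _ ih => cond (a.beq y) ih (a :: ih))
      [Pt.p0, .p1, .p2, .p3, .p4, .p5, .p6]))

/-- All permutations fixing `y`, as columns. -/
def perms (y : Pt) : List Col :=
  choices y .p0 [] (fun a =>
  choices y .p1 [a] fun b =>
  choices y .p2 [b, a] fun c =>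
  choices y .p3 [c, b, a] fun d =>
  choices y .p4 [d, c, b, a] fun e =>
  choices y .p5 [e, d, c, b, a] fun f =>
  choices y .p6 [f, e, d, c, b, a] fun g acc => ⟨a, b, c, d, e, f, g⟩ :: acc) []

/-- Whether the column `p` at `y` satisfies the requirements not involving other columns. -/
def proper (k : ℕ) (y : Pt) (p : Col) : Bool :=
  cond ((p.get y).beq y) (cond (k.ble p.key) p.inj false) false

/-- Whether the column `p` at `y` is compatible with the columns of `t` at the points in `asg`. -/
def compat (t : Tab) (asg : List Pt) (y : Pt) (p : Col) : Bool :=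
  List.rec true (fun a _ ih =>
    cond
      ((p.get a).force fun b => cond (b.mem asg) ((t.get b).intertwines p (t.get a)) true)
      (cond
        ((t.get a).force fun r => (r.get y).force fun b =>
          cond (b.beq y) (p.intertwines r p) (cond (b.mem asg) ((t.get b).intertwines r p) true))
        ih false) false) asg

/-- Whether the column `p` at `y` is what the columns of `t` at the points in `asg` force it to be,
if anything. -/
def compatImage (t : Tab) (asg : List Pt) (y : Pt) (p : Col) : Bool :=
  List.rec true (fun a _ ih =>
    List.rec ih (fun b _ ih' =>
      cond (((t.get b).get a).beq y)
        (cond (p.intertwines (t.get b) (t.get a)) ih' false) ih') asg) asg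

/-- The column at `y` if it is determined by the columns of `t` at the points in `asg`. -/
def forced (t : Tab) (asg : List Pt) (y : Pt) : Option Col :=
  List.rec none (fun a _ ih =>
    List.rec ih (fun b _ ih' =>
      cond (((t.get b).get a).beq y) (some ((t.get b).conj (t.get a))) ih') asg) asg

/-- The weight of an operation table. -/
def weight (k : ℕ) (t : Tab) : ℕ :=
  Nat.div 420 (Pt.count fun y => (t.get y).key.beq k)

/-- The sum of `g` over the members of a list satisfying `q`. -/
def sumIf {α : Type} (q : α → Bool) (g : α → ℕ) (l : List α) : ℕ :=
  List.rec 0 (fun a _ ih => cond (q a) (Nat.add (g a) ih) ih) l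

/-- Sum of the weights of the admissible tables that agree with `t` at the points in `asg`. -/
def search (k : ℕ) (B : Pt → List Col) (ys : List Pt) : List Pt → Tab → ℕ :=
  List.rec (fun _ t => weight k t)
    (fun y _ ih asg t => t.force fun t =>
      sumIf (fun p => cond (compat t asg y p)
          (cond (compatImage t asg y p) (proper k y p) false) false)
        (fun p => ih (y :: asg) (t.set y p))
        (Option.rec (B y) (fun p => p.force fun p => [p]) (forced t asg y))) ys

/-- The candidate columns at `y` when the column at `p0` is `s`. -/
def candidates (s : Col) (y : Pt) : List Col :=
  (perms y).filter fun p =>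
    cond (compat ⟨s, s, s, s, s, s, s⟩ [.p0] y p) (s.key.ble p.key) false

/-- Sum of the weights of the admissible tables whose column at `p0` is `s`. -/
def total (s : Col) : ℕ :=
  search s.key (candidates s) [.p1, .p2, .p3, .p4, .p5, .p6] [.p0]
    ⟨s, s, s, s, s, s, s⟩

/-- Representatives of the cycle types of permutations fixing `p0`, with the values of `total`. -/
def reps : List (Col × ℕ) :=
  [(⟨.p0, .p1, .p2, .p3, .p4, .p5, .p6⟩, 60), (⟨.p0, .p2, .p1, .p3, .p4, .p5, .p6⟩, 47964),
   (⟨.p0, .p2, .p1, .p4, .p3, .p5, .p6⟩, 64848), (⟨.p0, .p2, .p1, .p4, .p3, .p6, .p5⟩, 36264),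
   (⟨.p0, .p2, .p3, .p1, .p4, .p5, .p6⟩, 32025), (⟨.p0, .p2, .p3, .p1, .p5, .p4, .p6⟩, 16590),
   (⟨.p0, .p2, .p3, .p4, .p5, .p6, .p1⟩, 540), (⟨.p0, .p2, .p3, .p1, .p5, .p6, .p4⟩, 4980),
   (⟨.p0, .p2, .p3, .p4, .p1, .p5, .p6⟩, 9548), (⟨.p0, .p2, .p3, .p4, .p1, .p6, .p5⟩, 3948),
   (⟨.p0, .p2, .p3, .p4, .p5, .p1, .p6⟩, 1680)]

/-- The value attached to the first member of `l` that is conjugate to `s`. -/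
def classValue (s : Col) (l : List (Col × ℕ)) : Option ℕ :=
  List.rec none (fun r _ ih => cond (s.key.beq r.1.key)
    (cond (List.rec false (fun q _ ih' => cond (s.intertwines q r.1) true ih') (perms .p0))
      (some r.2) ih) ih) l

/-- The sum of the class values of the members of `l`. -/
def sumClassValues (l : List Col) : Option ℕ :=
  List.rec (some 0) (fun s _ ih => Option.rec none
    (fun v => Option.rec none (fun w => some (Nat.add v w)) ih) (classValue s reps)) l

namespace Pt

@[simp] theorem beq_iff (a b : Pt) : a.beq b = true ↔ a = b := by
  cases a <;> cases b <;> simp [beq]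

theorem all_iff (f : Pt → Bool) : all f = true ↔ ∀ x, f x = true := by
  constructor
  · intro h x
    simp only [all, Bool.cond_false_right, Bool.and_eq_true] at h
    cases x <;> tauto
  · intro h
    simp [all, h]

theorem count_eq_card (f : Pt → Bool) :
    count f = (Finset.univ.filter fun x => f x = true).card := by
  have hu : (Finset.univ : Finset Pt) = {p0, p1, p2, p3, p4, p5, p6} := rfl
  have hc (b : Bool) (n : ℕ) : cond b n.succ n = (if b = true then 1 else 0) + n := by
    cases b <;> simp [Nat.add_comm]
  simp only [Finset.card_filter, hu, count, hc]
  simp [-Finset.sum_boole]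
  cases f p5 <;> simp [Nat.add_comm]

@[simp] theorem mem_iff (x : Pt) (l : List Pt) : x.mem l = true ↔ x ∈ l := by
  induction l with
  | nil => simp [mem]
  | cons a l ih =>
    change cond (x.beq a) true (x.mem l) = true ↔ _
    simp [ih]

@[simp] theorem force_eq {α : Type} (x : Pt) (k : Pt → α) : x.force k = k x := by
  cases x <;> rfl

theorem count_comp (e : Equiv.Perm Pt) (f : Pt → Bool) : count (fun x => f (e x)) = count f := by
  rw [count_eq_card, count_eq_card]
  exact Finset.card_equiv e (by simp)

theorem beq_congr {a b c d : Pt} (h : a = b ↔ c = d) : a.beq b = c.beq d := by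
  rw [Bool.eq_iff_iff, beq_iff, beq_iff, h]

theorem key_conj (e : Equiv.Perm Pt) (f : Pt → Pt) :
    key (fun x => e (f (e.symm x))) = key f := by
  unfold key
  rw [← count_comp e.symm fun x => (f (f x)).beq x, ← count_comp e.symm fun x => (f x).beq x]
  congr 3 <;> ext x <;> apply beq_congr <;> simp [Equiv.eq_symm_apply]

end Pt

namespace Vec7

variable {α : Type}

@[simp] theorem get_ofFn (f : Pt → α) (i : Pt) : (ofFn f).get i = f i := by
  cases i <;> rfl

@[ext] theorem ext_get {v w : Vec7 α} (h : ∀ i, v.get i = w.get i) : v = w := by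
  cases v
  cases w
  have h0 := h .p0
  have h1 := h .p1
  have h2 := h .p2
  have h3 := h .p3
  have h4 := h .p4
  have h5 := h .p5
  have h6 := h .p6
  simp only [get] at h0 h1 h2 h3 h4 h5 h6
  subst_vars
  rfl

@[simp] theorem force_eq {β : Type} (v : Vec7 α) (k : Vec7 α → β) : v.force k = k v := rfl

theorem get_set (v : Vec7 α) (i j : Pt) (y : α) :
    (v.set i y).get j = if j = i then y else v.get j := by
  cases i <;> cases j <;> rfl

end Vec7

namespace Col

theorem inj_iff (p : Col) : p.inj = true ↔ Function.Injective p.get := by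
  simp only [inj, Pt.all_iff, Function.Injective]
  refine forall₂_congr fun x y => ?_
  have h (b c : Bool) : cond b true (cond c false true) = true ↔ (c = true → b = true) := by
    cases b <;> cases c <;> simp
  rw [h, Pt.beq_iff, Pt.beq_iff]

theorem intertwines_iff (b q a : Col) :
    b.intertwines q a = true ↔ ∀ x, b.get (q.get x) = q.get (a.get x) := by
  simp [intertwines, Pt.all_iff]

theorem get_conj {q : Col} (hq : Function.Injective q.get) (a : Col) (x : Pt) :
    (q.conj a).get (q.get x) = q.get (a.get x) := by
  cases x <;> simp [conj, Vec7.get_set, hq.eq_iff]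

end Col

/-- The list-valued function `k` prepends an enumeration of the columns satisfying `P`. -/
def Enumerates (k : List Col → List Col) (P : Col → Prop) : Prop :=
  ∃ L : List Col, L.Nodup ∧ (∀ acc, k acc = L ++ acc) ∧ ∀ p, p ∈ L ↔ P p

theorem Enumerates.congr {k : List Col → List Col} {P Q : Col → Prop} (h : Enumerates k P)
    (hPQ : ∀ p, P p ↔ Q p) : Enumerates k Q := by
  obtain ⟨L, h1, h2, h3⟩ := h
  exact ⟨L, h1, h2, fun p => (h3 p).trans (hPQ p)⟩

theorem enumerates_choices {y x : Pt} {l : List Pt} {k : Pt → List Col → List Col}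
    {P : Col → Prop} (h : ∀ a, Enumerates (k a) fun p => P p ∧ p.get x = a) :
    Enumerates (choices y x l k) fun p => P p ∧ p.get x ∉ l ∧ (p.get x = y ↔ x = y) := by
  choose L h1 h2 h3 using h
  have key (o : List Pt) (ho : o.Nodup) :
      Enumerates (fun acc => List.rec acc (fun a _ ih => cond (a.mem l) ih (k a ih)) o)
        fun p => P p ∧ p.get x ∉ l ∧ p.get x ∈ o := by
    induction o with
    | nil => exact ⟨[], by simp, by simp, by simp⟩
    | cons a o ih =>
      obtain ⟨M, m1, m2, m3⟩ := ih (List.nodup_cons.1 ho).2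
      by_cases ha : a ∈ l
      · refine ⟨M, m1, fun acc => ?_, fun p => ?_⟩
        · simp [(Pt.mem_iff a l).2 ha, m2]
        · rw [m3]
          constructor
          · rintro ⟨i, j, n⟩
            exact ⟨i, j, List.mem_cons_of_mem _ n⟩
          · rintro ⟨i, j, n⟩
            refine ⟨i, j, (List.mem_cons.1 n).resolve_left ?_⟩
            rintro rfl
            exact j ha
      · have ha' : a.mem l = false := Bool.eq_false_iff.2 (mt (Pt.mem_iff a l).1 ha)
        refine ⟨L a ++ M, ?_, fun acc => ?_, fun p => ?_⟩
        · refine List.nodup_append'.2 ⟨h1 a, m1, fun p hp hp' => ?_⟩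
          have := ((h3 a p).1 hp).2
          have := ((m3 p).1 hp').2.2
          have := (List.nodup_cons.1 ho).1
          simp_all
        · change cond (a.mem l) _ (k a _) = _
          rw [ha', cond_false, h2, List.append_assoc]
          exact congrArg _ (m2 acc)
        · change _ ↔ P p ∧ p.get x ∉ l ∧ p.get x ∈ a :: o
          rw [List.mem_append, h3, m3, List.mem_cons]
          constructor
          · rintro (⟨i, rfl⟩ | ⟨i, j, n⟩)
            · exact ⟨i, ha, .inl rfl⟩
            · exact ⟨i, j, .inr n⟩
          · rintro ⟨i, j, rfl | n⟩
            · exact .inl ⟨i, rfl⟩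
            · exact .inr ⟨i, j, n⟩
  refine (key _ ?_).congr fun p => and_congr_right fun _ => and_congr_right fun _ => ?_
  · cases x <;> cases y <;> simp [Pt.beq]
  · generalize p.get x = a
    cases x <;> cases y <;> cases a <;> simp [Pt.beq]

theorem enumerates_singleton (a b c d e f g : Pt) :
    Enumerates (fun acc => ⟨a, b, c, d, e, f, g⟩ :: acc) fun p =>
      (p.get .p0 = a ∧ p.get .p1 = b ∧ p.get .p2 = c ∧ p.get .p3 = d ∧ p.get .p4 = e ∧
        p.get .p5 = f) ∧ p.get .p6 = g := by
  refine ⟨[⟨a, b, c, d, e, f, g⟩], by simp, by simp, fun p => ?_⟩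
  obtain ⟨⟩ := p
  simp [Vec7.get, and_assoc]

theorem enumerates_perms (y : Pt) :
    (perms y).Nodup ∧ ∀ p, p ∈ perms y ↔ p.get y = y ∧ Function.Injective p.get := by
  obtain ⟨L, h1, h2, h3⟩ : Enumerates
      (choices y .p0 [] fun a => choices y .p1 [a] fun b => choices y .p2 [b, a] fun c =>
        choices y .p3 [c, b, a] fun d => choices y .p4 [d, c, b, a] fun e =>
        choices y .p5 [e, d, c, b, a] fun f => choices y .p6 [f, e, d, c, b, a] fun g acc =>
          ⟨a, b, c, d, e, f, g⟩ :: acc)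
      fun p => p.get y = y ∧ Function.Injective p.get := by
    let C (i : Pt) (l : List Pt) (p : Col) : Prop :=
      p.get i ∉ l.map p.get ∧ (p.get i = y ↔ i = y)
    refine (enumerates_choices fun a => (enumerates_choices fun b => (enumerates_choices fun c =>
      (enumerates_choices fun d => (enumerates_choices fun e => (enumerates_choices fun f =>
      (enumerates_choices fun g => enumerates_singleton a b c d e f g).congr
        (Q := fun p => (p.get .p0 = a ∧ p.get .p1 = b ∧ p.get .p2 = c ∧ p.get .p3 = d ∧
          p.get .p4 = e ∧ C .p6 [.p5, .p4, .p3, .p2, .p1, .p0] p) ∧ p.get .p5 = f) ?_).congr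
        (Q := fun p => (p.get .p0 = a ∧ p.get .p1 = b ∧ p.get .p2 = c ∧ p.get .p3 = d ∧
          C .p5 [.p4, .p3, .p2, .p1, .p0] p ∧ C .p6 [.p5, .p4, .p3, .p2, .p1, .p0] p) ∧
          p.get .p4 = e) ?_).congr
        (Q := fun p => (p.get .p0 = a ∧ p.get .p1 = b ∧ p.get .p2 = c ∧
          C .p4 [.p3, .p2, .p1, .p0] p ∧ C .p5 [.p4, .p3, .p2, .p1, .p0] p ∧
          C .p6 [.p5, .p4, .p3, .p2, .p1, .p0] p) ∧ p.get .p3 = d) ?_).congr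
        (Q := fun p => (p.get .p0 = a ∧ p.get .p1 = b ∧ C .p3 [.p2, .p1, .p0] p ∧
          C .p4 [.p3, .p2, .p1, .p0] p ∧ C .p5 [.p4, .p3, .p2, .p1, .p0] p ∧
          C .p6 [.p5, .p4, .p3, .p2, .p1, .p0] p) ∧ p.get .p2 = c) ?_).congr
        (Q := fun p => (p.get .p0 = a ∧ C .p2 [.p1, .p0] p ∧ C .p3 [.p2, .p1, .p0] p ∧
          C .p4 [.p3, .p2, .p1, .p0] p ∧ C .p5 [.p4, .p3, .p2, .p1, .p0] p ∧
          C .p6 [.p5, .p4, .p3, .p2, .p1, .p0] p) ∧ p.get .p1 = b) ?_).congr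
        (Q := fun p => (C .p1 [.p0] p ∧ C .p2 [.p1, .p0] p ∧ C .p3 [.p2, .p1, .p0] p ∧
          C .p4 [.p3, .p2, .p1, .p0] p ∧ C .p5 [.p4, .p3, .p2, .p1, .p0] p ∧
          C .p6 [.p5, .p4, .p3, .p2, .p1, .p0] p) ∧ p.get .p0 = a) ?_).congr ?_
    rotate_right
    · intro p
      constructor
      · rintro ⟨⟨c1, c2, c3, c4, c5, c6⟩, -, c0⟩
        refine ⟨?_, fun i j hij => ?_⟩
        · have (i : Pt) : p.get i = y ↔ i = y := by
            cases i
            exacts [c0, c1.2, c2.2, c3.2, c4.2, c5.2, c6.2]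
          exact (this y).2 rfl
        · simp only [C, List.map_cons, List.map_nil, List.mem_cons, not_or] at c1 c2 c3 c4 c5 c6
          cases i <;> cases j <;> first | rfl | (exfalso; grind)
      · rintro ⟨hy, hp⟩
        have (i : Pt) : p.get i = y ↔ i = y := by
          conv_lhs => rw [← hy, hp.eq_iff]
        simp [C, hp.eq_iff, this]
    all_goals
      intro p
      simp only [C, List.map_cons, List.map_nil]
      grind
  have : perms y = L := (h2 []).trans (List.append_nil L)
  exact this ▸ ⟨h1, h3⟩

/-- A family `d` of self-maps such that `fun x y => d y x` is a quandle operation on `Pt`. -/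
def IsQuandleFamily (d : Pt → Pt → Pt) : Prop :=
  (∀ y, d y y = y) ∧ (∀ y, Function.Injective (d y)) ∧
    ∀ y z x, d (d z y) (d z x) = d z (d y x)

/-- The quandle axioms for `d`, as far as they only involve the maps at the points in `asg`,
together with a lower bound for the keys of these maps. -/
def Consistent (k : ℕ) (d : Pt → Pt → Pt) (asg : List Pt) : Prop :=
  (∀ y ∈ asg, d y y = y ∧ k ≤ Pt.key (d y) ∧ Function.Injective (d y)) ∧
    ∀ y ∈ asg, ∀ z ∈ asg, d z y ∈ asg → ∀ x, d (d z y) (d z x) = d z (d y x)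

/-- The quandle families all of whose members have key at least `k`. -/
def Admissible (k : ℕ) (d : Pt → Pt → Pt) : Prop :=
  IsQuandleFamily d ∧ ∀ y, k ≤ Pt.key (d y)

/-- The family of self-maps stored in a table. -/
def Tab.toFun (t : Tab) (y x : Pt) : Pt := (t.get y).get x

theorem Admissible.consistent {k : ℕ} {d : Pt → Pt → Pt} (h : Admissible k d) (asg : List Pt) :
    Consistent k d asg :=
  ⟨fun y _ => ⟨h.1.1 y, h.2 y, h.1.2.1 y⟩, fun y _ z _ _ => h.1.2.2 y z⟩

theorem Consistent.admissible {k : ℕ} {d : Pt → Pt → Pt} {asg : List Pt}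
    (h : Consistent k d asg) (ha : ∀ x, x ∈ asg) : Admissible k d :=
  ⟨⟨fun y => (h.1 y (ha y)).1, fun y => (h.1 y (ha y)).2.2,
    fun y z => h.2 y (ha y) z (ha z) (ha _)⟩, fun y => (h.1 y (ha y)).2.1⟩

theorem Consistent.congr {k : ℕ} {d d' : Pt → Pt → Pt} {asg : List Pt}
    (h : Consistent k d asg) (hd : ∀ a ∈ asg, d' a = d a) : Consistent k d' asg := by
  refine ⟨fun y hy => hd y hy ▸ h.1 y hy, fun y hy z hz hyz x => ?_⟩
  rw [hd z hz] at hyz ⊢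
  rw [hd _ hyz, hd y hy]
  exact h.2 y hy z hz hyz x

theorem compat_iff (t : Tab) (asg : List Pt) (y : Pt) (p : Col) :
    compat t asg y p = true ↔ ∀ a ∈ asg,
      (p.get a ∈ asg → ∀ x, t.toFun (p.get a) (p.get x) = p.get (t.toFun a x)) ∧
      (t.toFun a y = y → ∀ x, p.get (t.toFun a x) = t.toFun a (p.get x)) ∧
      (t.toFun a y ≠ y → t.toFun a y ∈ asg →
        ∀ x, t.toFun (t.toFun a y) (t.toFun a x) = t.toFun a (p.get x)) := by
  have hc (b c e : Bool) : cond b c e = true ↔ (b = true → c = true) ∧ (b ≠ true → e = true) := by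
    cases b <;> simp
  have hd (b c : Bool) : cond b c false = true ↔ b = true ∧ c = true := by
    cases b <;> simp
  have hi (b c : Bool) : cond b c true = true ↔ (b = true → c = true) := by
    cases b <;> simp
  suffices H : ∀ l : List Pt, List.rec (motive := fun _ => Bool) true (fun a _ ih =>
      cond
        ((p.get a).force fun b => cond (b.mem asg) ((t.get b).intertwines p (t.get a)) true)
        (cond
          ((t.get a).force fun r => (r.get y).force fun b =>
            cond (b.beq y) (p.intertwines r p) (cond (b.mem asg) ((t.get b).intertwines r p) true))
          ih false) false) l = true ↔ ∀ a ∈ l,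
      (p.get a ∈ asg → ∀ x, t.toFun (p.get a) (p.get x) = p.get (t.toFun a x)) ∧
      (t.toFun a y = y → ∀ x, p.get (t.toFun a x) = t.toFun a (p.get x)) ∧
      (t.toFun a y ≠ y → t.toFun a y ∈ asg →
        ∀ x, t.toFun (t.toFun a y) (t.toFun a x) = t.toFun a (p.get x)) from H asg
  intro l
  induction l with
  | nil => simp
  | cons a l ih =>
    rw [List.forall_mem_cons, ← ih, and_assoc, hd, hd]
    refine and_congr ?_ (and_congr ?_ Iff.rfl)
    · rw [Pt.force_eq, hi, Pt.mem_iff, Col.intertwines_iff]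
      rfl
    · rw [Vec7.force_eq, Pt.force_eq, hc, hi, ne_eq, Pt.mem_iff, Col.intertwines_iff,
        Col.intertwines_iff, Pt.beq_iff]
      rfl

theorem compatImage_iff (t : Tab) (asg : List Pt) (y : Pt) (p : Col) :
    compatImage t asg y p = true ↔ ∀ a ∈ asg, ∀ b ∈ asg, t.toFun b a = y →
      ∀ x, p.get (t.toFun b x) = t.toFun b (t.toFun a x) := by
  have key (s : List Pt) (f : Pt → Bool → Bool) (P : Pt → Prop)
      (hf : ∀ a b, f a b = true ↔ P a ∧ b = true) (b : Bool) :
      List.rec (motive := fun _ => Bool) b (fun a _ ih => f a ih) s = true ↔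
        (∀ a ∈ s, P a) ∧ b = true := by
    induction s with
    | nil => simp
    | cons a s ih =>
      refine (hf a _).trans ?_
      rw [ih]
      simp [and_assoc]
  unfold compatImage
  rw [key asg _ (fun a => ∀ b ∈ asg, t.toFun b a = y →
      ∀ x, p.get (t.toFun b x) = t.toFun b (t.toFun a x))]
  · simp
  · intro a b
    refine key asg _ (fun b => t.toFun b a = y →
      ∀ x, p.get (t.toFun b x) = t.toFun b (t.toFun a x)) (fun b c => ?_) _
    have hc (b c e : Bool) :
        cond b (cond c e false) e = true ↔ (b = true → c = true) ∧ e = true := by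
      cases b <;> simp
    rw [hc, Pt.beq_iff, Col.intertwines_iff]
    rfl

theorem proper_iff (k : ℕ) (y : Pt) (p : Col) :
    proper k y p = true ↔ p.get y = y ∧ k ≤ Pt.key p.get ∧ Function.Injective p.get := by
  have hd (b c : Bool) : cond b c false = true ↔ b = true ∧ c = true := by
    cases b <;> simp
  rw [proper, hd, hd, Pt.beq_iff, Col.inj_iff]
  exact and_congr_right fun _ => and_congr_left fun _ => by rw [Nat.ble_eq, Col.key]

theorem Tab.toFun_set_self (t : Tab) (y : Pt) (p : Col) : Tab.toFun (t.set y p) y = p.get := by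
  funext x
  simp [Tab.toFun, Vec7.get_set]

theorem Tab.toFun_set_of_ne (t : Tab) {y z : Pt} (h : z ≠ y) (p : Col) :
    Tab.toFun (t.set y p) z = t.toFun z := by
  funext x
  simp [Tab.toFun, Vec7.get_set, h]

theorem consistent_set_iff {k : ℕ} {t : Tab} {asg : List Pt} {y : Pt} (hy : y ∉ asg)
    (h : Consistent k t.toFun asg) (p : Col) :
    cond (compat t asg y p) (cond (compatImage t asg y p) (proper k y p) false) false = true ↔
      Consistent k (Tab.toFun (t.set y p)) (y :: asg) := by
  have hd (b c : Bool) : cond b c false = true ↔ b = true ∧ c = true := by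
    cases b <;> simp
  have hs := t.toFun_set_self y p
  have hn {a : Pt} (ha : a ∈ asg) : Tab.toFun (t.set y p) a = t.toFun a :=
    t.toFun_set_of_ne (by rintro rfl; exact hy ha) p
  rw [hd, hd, compat_iff, compatImage_iff, proper_iff]
  generalize Tab.toFun (t.set y p) = d at hs hn
  have hinj {a : Pt} (ha : a ∈ asg) (haa : t.toFun a y = a) : False := by
    have h1 := h.1 a ha
    exact hy (h1.2.2 (haa.trans h1.1.symm) ▸ ha)
  constructor
  · rintro ⟨h1, h2, h3⟩
    refine ⟨fun z hz => ?_, fun z hz' w hw' hwz x => ?_⟩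
    · obtain rfl | hz := List.mem_cons.1 hz
      · rwa [hs]
      · rw [hn hz]
        exact h.1 z hz
    · obtain rfl | hz := List.mem_cons.1 hz'
      · obtain rfl | hw := List.mem_cons.1 hw'
        · simp [hs, h3.1]
        · rw [hn hw] at hwz ⊢
          rw [hs]
          by_cases hzw : t.toFun w z = z
          · rw [hzw, hs]
            exact (h1 w hw).2.1 hzw x
          · have hm := (List.mem_cons.1 hwz).resolve_left hzw
            rw [hn hm]
            exact (h1 w hw).2.2 hzw hm x
      · obtain rfl | hw := List.mem_cons.1 hw'
        · rw [hs] at hwz ⊢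
          rw [hn hz]
          obtain hzw | hm := List.mem_cons.1 hwz
          · have := h3.2.2 (hzw.trans h3.1.symm)
            exact absurd (this ▸ hz) hy
          · rw [hn hm]
            exact (h1 z hz).1 hm x
        · rw [hn hw] at hwz ⊢
          rw [hn hz]
          obtain hzw | hm := List.mem_cons.1 hwz
          · rw [hzw, hs]
            exact h2 z hz w hw hzw x
          · rw [hn hm]
            exact h.2 z hz w hw hm x
  · rintro ⟨h1, h2⟩
    have hy' : y ∈ y :: asg := List.mem_cons_self
    refine ⟨fun a ha => ⟨fun hm x => ?_, fun hm x => ?_, fun _ hm x => ?_⟩,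
      fun a ha b hb hm x => ?_, ?_⟩
    · have := h2 a (.tail _ ha) y hy' (by rw [hs]; exact .tail _ hm) x
      rwa [hs, hn hm, hn ha] at this
    · have := h2 y hy' a (.tail _ ha) (by rw [hn ha, hm]; exact hy') x
      rwa [hn ha, hm, hs] at this
    · have := h2 y hy' a (.tail _ ha) (by rw [hn ha]; exact .tail _ hm) x
      rwa [hn ha, hs, hn hm] at this
    · have := h2 a (.tail _ ha) b (.tail _ hb) (by rw [hn hb, hm]; exact hy') x
      rwa [hn hb, hm, hs, hn ha] at this
    · have := h1 y hy'
      rwa [hs] at this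

/-- The weight of a family of self-maps: `420` divided by the number of members with key `k`. -/
def familyWeight (k : ℕ) (d : Pt → Pt → Pt) : ℕ :=
  420 / Pt.count fun y => (Pt.key (d y)).beq k

open Classical in
/-- The sum of the weights of the admissible families that agree with `e` on `asg`. -/
def extensionSum (k : ℕ) (asg : List Pt) (e : Pt → Pt → Pt) : ℕ :=
  ∑ d with Admissible k d ∧ ∀ a ∈ asg, d a = e a, familyWeight k d

theorem sumIf_eq {α : Type} (q : α → Bool) (g : α → ℕ) (l : List α) :
    sumIf q g l = (l.map fun a => if q a = true then g a else 0).sum := by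
  induction l with
  | nil => rfl
  | cons a l ih =>
    change cond (q a) (g a + sumIf q g l) (sumIf q g l) = _
    rw [List.map_cons, List.sum_cons, ih]
    cases q a <;> simp

theorem extensionSum_eq_sum {k : ℕ} {asg : List Pt} {t : Tab} {y : Pt} (hy : y ∉ asg)
    {L : List Col} (hL : L.Nodup)
    (h : ∀ d, Admissible k d → (∀ a ∈ asg, d a = t.toFun a) → Vec7.ofFn (d y) ∈ L) :
    extensionSum k asg t.toFun =
      (L.map fun p => extensionSum k (y :: asg) (Tab.toFun (t.set y p))).sum := by
  classical
  rw [← List.sum_toFinset _ hL, extensionSum,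
    ← Finset.sum_fiberwise_of_maps_to (t := L.toFinset) (g := fun d => Vec7.ofFn (d y))]
  swap
  · simp only [Finset.mem_filter, Finset.mem_univ, true_and, List.mem_toFinset, and_imp]
    exact h
  refine Finset.sum_congr rfl fun p _ => ?_
  rw [extensionSum]
  refine Finset.sum_congr ?_ fun _ _ => rfl
  rw [Finset.filter_filter]
  refine Finset.filter_congr fun d _ => ?_
  rw [List.forall_mem_cons, t.toFun_set_self, and_assoc, and_comm (b := Vec7.ofFn (d y) = p)]
  refine and_congr_right fun _ => and_congr ⟨?_, fun h => ?_⟩ (forall₂_congr fun a ha => ?_)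
  · rintro rfl
    funext x
    simp
  · ext x
    simp [h]
  · rw [t.toFun_set_of_ne (by rintro rfl; exact hy ha)]

theorem forced_eq_some {t : Tab} {asg : List Pt} {y : Pt} {p : Col}
    (h : forced t asg y = some p) :
    ∃ a ∈ asg, ∃ b ∈ asg, t.toFun b a = y ∧ p = (t.get b).conj (t.get a) := by
  have key (s : List Pt) (f : Pt → Option Col → Option Col) (P : Pt → Prop) (o : Option Col)
      (hf : ∀ a o, f a o = some p → P a ∨ o = some p)
      (h : List.rec (motive := fun _ => Option Col) o (fun a _ ih => f a ih) s = some p) :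
      (∃ a ∈ s, P a) ∨ o = some p := by
    induction s with
    | nil => exact .inr h
    | cons a s ih =>
      obtain h | h := hf a _ h
      · exact .inl ⟨a, List.mem_cons_self, h⟩
      · obtain ⟨b, hb, h⟩ | h := ih h
        · exact .inl ⟨b, .tail _ hb, h⟩
        · exact .inr h
  refine (key asg _ (fun a => ∃ b ∈ asg, t.toFun b a = y ∧ p = (t.get b).conj (t.get a)) none
    (fun a o h => key asg _ (fun b => t.toFun b a = y ∧ p = (t.get b).conj (t.get a)) o
      (fun b o h => ?_) h) h).resolve_right (by simp)
  change cond (Pt.beq (t.toFun b a) y) (some ((t.get b).conj (t.get a))) o = some p at h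
  cases hb : Pt.beq (t.toFun b a) y with
  | false => exact .inr (by simpa [hb] using h)
  | true =>
    rw [hb, cond_true, Option.some_inj] at h
    exact .inl ⟨(Pt.beq_iff _ _).1 hb, h.symm⟩

theorem IsQuandleFamily.apply_eq_conj {d : Pt → Pt → Pt} (hd : IsQuandleFamily d) {q r : Col}
    {a b : Pt} (hr : d a = r.get) (hq : d b = q.get) : d (d b a) = (q.conj r).get := by
  have hi := hd.2.1 b
  funext x
  obtain ⟨x, rfl⟩ := Finite.surjective_of_injective hi x
  rw [hd.2.2, hr, hq, Col.get_conj (hq ▸ hi)]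

theorem search_eq_extensionSum {k : ℕ} {s : Pt → Pt} {B : Pt → List Col}
    (hB : ∀ y, (B y).Nodup)
    (hB' : ∀ d, Admissible k d → d .p0 = s → ∀ y ≠ Pt.p0, Vec7.ofFn (d y) ∈ B y) (ys : List Pt) :
    ∀ (asg : List Pt) (t : Tab), ys.Nodup → (∀ x ∈ ys, x ∉ asg) → (∀ x, x ∈ ys ∨ x ∈ asg) →
      .p0 ∈ asg → t.toFun .p0 = s → Consistent k t.toFun asg →
      search k B ys asg t = extensionSum k asg t.toFun := by
  classical
  induction ys with
  | nil =>
    intro asg t _ _ hm _ _ hc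
    replace hm (x : Pt) : x ∈ asg := by simpa using hm x
    have : (Finset.univ.filter fun d => Admissible k d ∧ ∀ a ∈ asg, d a = t.toFun a) =
        {t.toFun} := by
      ext d
      simp only [Finset.mem_filter, Finset.mem_univ, true_and, Finset.mem_singleton]
      constructor
      · rintro ⟨-, h⟩
        exact funext fun a => h a (hm a)
      · rintro rfl
        exact ⟨hc.admissible hm, fun _ _ => rfl⟩
    rw [extensionSum, this, Finset.sum_singleton]
    rfl
  | cons y ys ih =>
    intro asg t hys hd hm h0 hs hc
    obtain ⟨hy, hys⟩ := List.nodup_cons.1 hys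
    have hya : y ∉ asg := hd y List.mem_cons_self
    have main (L : List Col) (hL : L.Nodup)
        (h : ∀ d, Admissible k d → (∀ a ∈ asg, d a = t.toFun a) → Vec7.ofFn (d y) ∈ L) :
        sumIf (fun p => cond (compat t asg y p)
          (cond (compatImage t asg y p) (proper k y p) false) false)
          (fun p => search k B ys (y :: asg) (t.set y p)) L = extensionSum k asg t.toFun := by
      rw [sumIf_eq, extensionSum_eq_sum hya hL h]
      refine congrArg List.sum (List.map_congr_left fun p _ => ?_)
      split_ifs with hp
      all_goals rw [consistent_set_iff hya hc] at hp
      · refine ih _ _ hys (fun x hx => ?_) (fun x => ?_) (.tail _ h0) ?_ hp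
        · rw [List.mem_cons, not_or]
          exact ⟨by rintro rfl; exact hy hx, hd x (.tail _ hx)⟩
        · have := hm x
          rw [List.mem_cons] at this ⊢
          tauto
        · rw [t.toFun_set_of_ne (by rintro rfl; exact hya h0), hs]
      · symm
        rw [extensionSum, Finset.filter_false_of_mem, Finset.sum_empty]
        rintro d - ⟨h1, h2⟩
        exact hp ((h1.consistent _).congr fun a ha => (h2 a ha).symm)
    change sumIf _ _ (Option.rec (B y) (fun p => p.force fun p => [p]) (forced t asg y)) = _
    cases hf : forced t asg y with
    | none =>
      exact main (B y) (hB y) fun d h1 h2 =>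
        hB' d h1 ((h2 _ h0).trans hs) y (by rintro rfl; exact hya h0)
    | some p =>
      refine main [p] (List.nodup_singleton p) fun d h1 h2 => ?_
      obtain ⟨a, ha, b, hb, hab, rfl⟩ := forced_eq_some hf
      rw [List.mem_singleton]
      rw [← h2 b hb] at hab
      ext x
      rw [Vec7.get_ofFn, ← hab, h1.1.apply_eq_conj (q := t.get b) (r := t.get a) (h2 a ha)
        (h2 b hb)]

theorem ofFn_mem_candidates {s : Col} {d : Pt → Pt → Pt} (h : Admissible s.key d)
    (hs : d .p0 = s.get) {y : Pt} (hy : y ≠ .p0) : Vec7.ofFn (d y) ∈ candidates s y := by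
  have hp : (Vec7.ofFn (d y)).get = d y := funext fun x => Vec7.get_ofFn _ x
  have h0 : d .p0 = Tab.toFun ⟨s, s, s, s, s, s, s⟩ .p0 := hs
  have hc := (consistent_set_iff (y := y) (by simpa using hy)
    ((h.consistent [.p0]).congr (d' := Tab.toFun ⟨s, s, s, s, s, s, s⟩) (by simp [h0]))
    (Vec7.ofFn (d y))).2 ((h.consistent _).congr fun a ha => by
      obtain rfl | ha := List.mem_cons.1 ha
      · rw [Tab.toFun_set_self, hp]
      · rw [List.mem_singleton.1 ha, Tab.toFun_set_of_ne _ hy.symm, h0])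
  rw [candidates, List.mem_filter, (enumerates_perms y).2, hp]
  refine ⟨⟨h.1.1 y, h.1.2.1 y⟩, ?_⟩
  rw [Bool.cond_false_right, Bool.and_eq_true] at hc ⊢
  refine ⟨hc.1, ?_⟩
  rw [Nat.ble_eq, Col.key, Col.key, hp]
  exact h.2 y

theorem total_eq_extensionSum {s : Col} (hs : proper s.key .p0 s = true) :
    total s = extensionSum s.key [.p0] fun _ => s.get := by
  rw [proper_iff] at hs
  have h : Tab.toFun ⟨s, s, s, s, s, s, s⟩ = fun _ => s.get := by
    funext y x
    cases y <;> rfl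
  rw [total, search_eq_extensionSum (s := s.get) (B := candidates s)
    (fun y => (enumerates_perms y).1.filter _)
    (fun d h1 h2 y hy => ofFn_mem_candidates h1 h2 hy), h]
  · simp
  · simp
  · intro x
    cases x <;> simp
  · simp
  · rw [h]
  · rw [h]
    refine ⟨by simpa using hs, fun y hy z hz _ x => rfl⟩

/-- Transport of a family of self-maps along a permutation. -/
def transport (e : Equiv.Perm Pt) : Equiv.Perm (Pt → Pt → Pt) :=
  e.arrowCongr (e.arrowCongr e)

theorem transport_apply (e : Equiv.Perm Pt) (d : Pt → Pt → Pt) (y : Pt) :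
    transport e d (e y) = fun x => e (d y (e.symm x)) := by
  funext x
  simp [transport, Equiv.arrowCongr]

theorem IsQuandleFamily.transport {d : Pt → Pt → Pt} (h : IsQuandleFamily d)
    (e : Equiv.Perm Pt) : IsQuandleFamily (transport e d) := by
  refine ⟨fun y => ?_, fun y => ?_, fun y z x => ?_⟩
  all_goals obtain ⟨y, rfl⟩ := e.surjective y
  · simp [transport_apply, h.1]
  · rw [transport_apply]
    exact e.injective.comp ((h.2.1 y).comp e.symm.injective)
  · obtain ⟨z, rfl⟩ := e.surjective z
    simp [transport_apply, h.2.2]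

theorem transport_symm (e : Equiv.Perm Pt) : transport e.symm = (transport e).symm := rfl

theorem key_transport (e : Equiv.Perm Pt) (d : Pt → Pt → Pt) (y : Pt) :
    Pt.key (transport e d (e y)) = Pt.key (d y) := by
  rw [transport_apply, Pt.key_conj]

theorem Admissible.transport {k : ℕ} {d : Pt → Pt → Pt} (h : Admissible k d)
    (e : Equiv.Perm Pt) : Admissible k (transport e d) := by
  refine ⟨h.1.transport e, fun y => ?_⟩
  obtain ⟨y, rfl⟩ := e.surjective y
  rw [key_transport]
  exact h.2 y

theorem admissible_transport_iff {k : ℕ} {d : Pt → Pt → Pt} (e : Equiv.Perm Pt) :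
    Admissible k (transport e d) ↔ Admissible k d := by
  refine ⟨fun h => ?_, fun h => h.transport e⟩
  simpa [transport_symm] using h.transport e.symm

theorem familyWeight_transport (k : ℕ) (e : Equiv.Perm Pt) (d : Pt → Pt → Pt) :
    familyWeight k (transport e d) = familyWeight k d := by
  rw [familyWeight, ← Pt.count_comp e]
  simp only [key_transport]
  rfl

open Classical in
/-- The sum of the weights of the quandle families `d` with `d y = s` for which `s` has the least
key. -/
def columnSum (y : Pt) (s : Pt → Pt) : ℕ :=
  ∑ d, if Admissible (Pt.key s) d ∧ d y = s then familyWeight (Pt.key s) d else 0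

theorem columnSum_zero (s : Pt → Pt) :
    columnSum .p0 s = extensionSum (Pt.key s) [.p0] fun _ => s := by
  classical
  rw [columnSum, extensionSum, Finset.sum_filter]
  exact Finset.sum_congr rfl fun d _ => if_congr (by simp) rfl rfl

theorem columnSum_conj (e : Equiv.Perm Pt) (y : Pt) (s : Pt → Pt) :
    columnSum (e y) (fun x => e (s (e.symm x))) = columnSum y s := by
  classical
  rw [columnSum, ← Equiv.sum_comp (transport e)]
  refine Finset.sum_congr rfl fun d _ => ?_
  rw [Pt.key_conj, admissible_transport_iff, familyWeight_transport, transport_apply]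
  have : ((fun x => e (d y (e.symm x))) = fun x => e (s (e.symm x))) ↔ d y = s :=
    (e.arrowCongr e).injective.eq_iff
  simp only [this]

theorem sum_columnSum_eq (y : Pt) : ∑ s, columnSum y s = ∑ s, columnSum .p0 s := by
  rw [← ((Equiv.swap .p0 y).arrowCongr (Equiv.swap .p0 y)).sum_comp]
  refine Finset.sum_congr rfl fun s _ => ?_
  refine Eq.trans ?_ (columnSum_conj (Equiv.swap .p0 y) .p0 s)
  rw [Equiv.swap_apply_left]
  rfl

open Classical in
theorem sum_columnSum (y : Pt) : ∑ s, columnSum y s =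
    ∑ d, if Admissible (Pt.key (d y)) d then familyWeight (Pt.key (d y)) d else 0 := by
  simp only [columnSum]
  rw [Finset.sum_comm]
  refine Finset.sum_congr rfl fun d _ => ?_
  rw [Finset.sum_eq_single (d y) (fun s _ hs => if_neg fun h => hs h.2.symm) (by simp)]
  simp

open Classical in
theorem sum_familyWeight (d : Pt → Pt → Pt) :
    (∑ y, if Admissible (Pt.key (d y)) d then familyWeight (Pt.key (d y)) d else 0) =
      if IsQuandleFamily d then 420 else 0 := by
  split_ifs with hd
  · have : Nonempty Pt := ⟨.p0⟩
    obtain ⟨m, hm⟩ := Finite.exists_min fun y => Pt.key (d y)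
    have (y : Pt) : Admissible (Pt.key (d y)) d ↔ Pt.key (d y) = Pt.key (d m) :=
      ⟨fun h => (h.2 m).antisymm (hm y), fun h => ⟨hd, fun z => h.trans_le (hm z)⟩⟩
    have hw (y : Pt) : (if Admissible (Pt.key (d y)) d then familyWeight (Pt.key (d y)) d else 0) =
        if Pt.key (d y) = Pt.key (d m) then familyWeight (Pt.key (d m)) d else 0 := by
      simp only [this]
      split_ifs with h
      · rw [h]
      · rfl
    have hn : Pt.count (fun y => (Pt.key (d y)).beq (Pt.key (d m))) =
        (Finset.univ.filter fun y => Pt.key (d y) = Pt.key (d m)).card := by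
      rw [Pt.count_eq_card]
      simp only [Nat.beq_eq]
    rw [Finset.sum_congr rfl fun y _ => hw y, ← Finset.sum_filter, Finset.sum_const,
      familyWeight, hn, smul_eq_mul]
    have h1 : 0 < (Finset.univ.filter fun y => Pt.key (d y) = Pt.key (d m)).card :=
      Finset.card_pos.2 ⟨m, by simp⟩
    have h2 : (Finset.univ.filter fun y => Pt.key (d y) = Pt.key (d m)).card ≤ 7 :=
      Finset.card_le_univ _
    generalize (Finset.univ.filter fun y => Pt.key (d y) = Pt.key (d m)).card = c at h1 h2
    interval_cases c <;> rfl
  · exact Finset.sum_eq_zero fun y _ => if_neg fun h => hd h.1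

theorem sum_ite_const {α : Type*} [Fintype α] (p : α → Prop) [DecidablePred p] (c : ℕ) :
    (∑ a, if p a then c else 0) = c * Nat.card {a // p a} := by
  rw [← Finset.sum_filter, Finset.sum_const, Nat.card_eq_fintype_card, Fintype.card_subtype,
    smul_eq_mul, mul_comm]

theorem Pt.sum_const (c : ℕ) : ∑ _y : Pt, c = 7 * c := by
  rw [Finset.sum_const, smul_eq_mul, Finset.card_univ, show Fintype.card Pt = 7 from rfl]

theorem card_isQuandleFamily :
    420 * Nat.card {d // IsQuandleFamily d} = 7 * ∑ s, columnSum .p0 s := by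
  classical
  rw [← Pt.sum_const, ← Finset.sum_congr rfl fun y _ => sum_columnSum_eq y,
    Finset.sum_congr rfl fun y _ => sum_columnSum y, Finset.sum_comm,
    Finset.sum_congr rfl fun d _ => sum_familyWeight d, sum_ite_const]

theorem sum_columnSum_eq_perms :
    ∑ s, columnSum .p0 s = ((perms .p0).map fun p => columnSum .p0 p.get).sum := by
  classical
  rw [← List.sum_toFinset _ (enumerates_perms .p0).1]
  symm
  refine Finset.sum_of_injOn Vec7.get ?_ ?_ ?_ fun _ _ => rfl
  · exact fun p _ q _ h => Vec7.ext_get (congrFun h)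
  · exact fun _ _ => Finset.mem_coe.2 (Finset.mem_univ _)
  · intro s _ hs
    refine Finset.sum_eq_zero fun d _ => if_neg ?_
    rintro ⟨h, rfl⟩
    have hp : (Vec7.ofFn (d .p0)).get = d .p0 := funext fun x => Vec7.get_ofFn _ x
    refine hs ⟨Vec7.ofFn (d .p0), ?_, hp⟩
    rw [List.coe_toFinset, Set.mem_ofPred_eq, (enumerates_perms _).2, hp]
    exact ⟨h.1.1 _, h.1.2.1 _⟩

theorem classValue_eq_some {s : Col} {l : List (Col × ℕ)} {v : ℕ} (h : classValue s l = some v) :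
    ∃ r ∈ l, ∃ q ∈ perms .p0, s.intertwines q r.1 = true ∧ r.2 = v := by
  have key (m : List Col) (r : Col) (h : List.rec (motive := fun _ => Bool) false
      (fun q _ ih' => cond (s.intertwines q r) true ih') m = true) :
      ∃ q ∈ m, s.intertwines q r = true := by
    induction m with
    | nil => cases h
    | cons q m ih =>
      change cond (s.intertwines q r) true _ = true at h
      rw [Bool.cond_true_left, Bool.or_eq_true] at h
      obtain h | h := h
      · exact ⟨q, List.mem_cons_self, h⟩
      · obtain ⟨q', hq, h⟩ := ih h
        exact ⟨q', .tail _ hq, h⟩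
  induction l with
  | nil => cases h
  | cons r l ih =>
    have hi (h : classValue s l = some v) :
        ∃ r' ∈ r :: l, ∃ q ∈ perms .p0, s.intertwines q r'.1 = true ∧ r'.2 = v := by
      obtain ⟨r, hr, h⟩ := ih h
      exact ⟨r, .tail _ hr, h⟩
    change cond _ (cond _ (some r.2) (classValue s l)) (classValue s l) = some v at h
    rw [cond_eq_ite, cond_eq_ite] at h
    split_ifs at h with h1 h2
    · obtain ⟨q, hq, h2⟩ := key (perms .p0) r.1 h2
      exact ⟨r, List.mem_cons_self, q, hq, h2, Option.some_inj.1 h⟩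
    · exact hi h
    · exact hi h

theorem columnSum_eq_of_intertwines {s q r : Col} (hq : q ∈ perms .p0)
    (h : s.intertwines q r = true) : columnSum .p0 s.get = columnSum .p0 r.get := by
  rw [(enumerates_perms _).2] at hq
  rw [Col.intertwines_iff] at h
  let e : Equiv.Perm Pt := Equiv.ofBijective q.get (Finite.injective_iff_bijective.1 hq.2)
  have he : e .p0 = .p0 := hq.1
  rw [← columnSum_conj e .p0 r.get, he]
  congr 1
  funext x
  obtain ⟨x, rfl⟩ := e.surjective x
  rw [e.symm_apply_apply]
  exact h x

theorem sum_eq_of_sumClassValues {f : Col → ℕ} {l : List Col} {n : ℕ}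
    (h : sumClassValues l = some n)
    (hf : ∀ s v, classValue s reps = some v → f s = v) : (l.map f).sum = n := by
  induction l generalizing n with
  | nil => exact Option.some_inj.1 h
  | cons s l ih =>
    change Option.rec none (fun v => Option.rec none (fun w => some (Nat.add v w))
      (sumClassValues l)) (classValue s reps) = some n at h
    cases hv : classValue s reps with
    | none => simp [hv] at h
    | some v =>
      cases hw : sumClassValues l with
      | none => simp [hv, hw] at h
      | some w =>
        simp only [hv, hw, Option.some_inj] at h
        rw [List.map_cons, List.sum_cons, hf s v hv, ih hw]
        exact h

theorem isQuandleFamily_iff (d : Pt → Pt → Pt) :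
    IsQuandleFamily d ↔ IsQuandleOp fun x y => d y x := by
  refine and_congr_right fun _ => and_congr ?_ ?_
  · rw [forall_comm]
    refine forall_congr' fun y => ?_
    rw [Finite.injective_iff_bijective, Function.bijective_iff_existsUnique]
    simp only [eq_comm]
  · constructor
    · exact fun h x y z => (h y z x).symm
    · exact fun h y z x => (h x y z).symm

theorem IsQuandleOp.transport {α β : Type*} {op : α → α → α} (h : IsQuandleOp op) (e : α ≃ β) :
    IsQuandleOp fun x y => e (op (e.symm x) (e.symm y)) := by
  refine ⟨fun x => by simp [h.1], fun x y => ?_, fun x y z => ?_⟩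
  · obtain ⟨z, hz, hu⟩ := h.2.1 (e.symm x) (e.symm y)
    refine ⟨e z, by simp [← hz], fun w hw => ?_⟩
    rw [← hu (e.symm w) (by simp [hw]), e.apply_symm_apply]
  · simp only [e.symm_apply_apply]
    rw [h.2.2]

theorem card_isQuandleOp_congr {α β : Type*} (e : α ≃ β) :
    Nat.card {op : α → α → α // IsQuandleOp op} = Nat.card {op : β → β → β // IsQuandleOp op} :=
  Nat.card_congr ((e.arrowCongr (e.arrowCongr e)).subtypeEquiv fun op =>
    ⟨fun h => h.transport e, fun h => by
      simpa [Equiv.arrowCongr, Function.comp_def] using h.transport e.symm⟩)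

theorem sumClassValues_perms : sumClassValues (perms .p0) = some 9174000 := by decide +kernel

theorem proper_of_mem_reps : ∀ r ∈ reps, proper r.1.key .p0 r.1 = true := by
  rw [← List.all_eq_true]
  decide +kernel

theorem total_one : total ⟨.p0, .p1, .p2, .p3, .p4, .p5, .p6⟩ = 60 := by decide +kernel

theorem total_transposition : total ⟨.p0, .p2, .p1, .p3, .p4, .p5, .p6⟩ = 47964 := by decide +kernel

theorem total_two_two : total ⟨.p0, .p2, .p1, .p4, .p3, .p5, .p6⟩ = 64848 := by decide +kernel

theorem total_two_two_two : total ⟨.p0, .p2, .p1, .p4, .p3, .p6, .p5⟩ = 36264 := by decide +kernel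

theorem total_three_cycle : total ⟨.p0, .p2, .p3, .p1, .p4, .p5, .p6⟩ = 32025 := by decide +kernel

theorem total_three_two : total ⟨.p0, .p2, .p3, .p1, .p5, .p4, .p6⟩ = 16590 := by decide +kernel

theorem total_six_cycle : total ⟨.p0, .p2, .p3, .p4, .p5, .p6, .p1⟩ = 540 := by decide +kernel

theorem total_three_three : total ⟨.p0, .p2, .p3, .p1, .p5, .p6, .p4⟩ = 4980 := by decide +kernel

theorem total_four_cycle : total ⟨.p0, .p2, .p3, .p4, .p1, .p5, .p6⟩ = 9548 := by decide +kernel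

theorem total_four_two : total ⟨.p0, .p2, .p3, .p4, .p1, .p6, .p5⟩ = 3948 := by decide +kernel

theorem total_five_cycle : total ⟨.p0, .p2, .p3, .p4, .p5, .p1, .p6⟩ = 1680 := by decide +kernel

theorem total_of_mem_reps : ∀ r ∈ reps, total r.1 = r.2 := by
  simp only [reps, List.forall_mem_cons]
  exact ⟨total_one, total_transposition, total_two_two, total_two_two_two, total_three_cycle,
    total_three_two, total_six_cycle, total_three_three, total_four_cycle, total_four_two,
    total_five_cycle, by simp⟩

theorem columnSum_eq_of_classValue {s : Col} {v : ℕ} (h : classValue s reps = some v) :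
    columnSum .p0 s.get = v := by
  obtain ⟨r, hr, q, hq, hi, rfl⟩ := classValue_eq_some h
  rw [columnSum_eq_of_intertwines hq hi, columnSum_zero, ← total_of_mem_reps r hr,
    total_eq_extensionSum (proper_of_mem_reps r hr)]
  rfl

theorem card_isQuandleOp_pt : Nat.card {op : Pt → Pt → Pt // IsQuandleOp op} = 152900 := by
  have h := card_isQuandleFamily
  rw [sum_columnSum_eq_perms, sum_eq_of_sumClassValues sumClassValues_perms
    fun s v => columnSum_eq_of_classValue,
    Nat.card_congr ((Equiv.piComm _).subtypeEquiv isQuandleFamily_iff)] at h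
  generalize Nat.card {op : Pt → Pt → Pt // IsQuandleOp op} = n at h
  omega

end

/-- There are exactly 152900 quandle structures on a 7-element set. -/
theorem card_quandles_order_seven :
    Nat.card {op : Fin 7 → Fin 7 → Fin 7 // IsQuandleOp op} = 152900 := by
  rw [card_isQuandleOp_congr (Fintype.equivOfCardEq (α := Fin 7) (β := Pt) rfl),
    card_isQuandleOp_pt]
end

section
/- The number of quandle structures on a set of 8 elements (equivalently, the number of 8 × 8 standard form quandle matrices) is 5225916: there are exactly 5225916 binary operations ▷ on {1,…,8} satisfying the three quandle axioms. -/
namespace QuandleCount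

open Equiv

/-! Quandle structures on `Fin 8` are counted by a backtracking search that the kernel evaluates. A
permutation of `Fin 8` is coded by a number whose base-64 digits are six times the images of the
points, so that both points and digit offsets are multiples of six. The functions below are
written with recursors and continuations, in a form that the kernel evaluates strictly. -/

/-- Case distinction on a Boolean. -/
def bite {α : Type} (c : Bool) (t e : α) : α := Bool.rec e t c

/-- Conjunction, evaluated from the left. -/
def band (a b : Bool) : Bool := Bool.rec false b a

/-- Implication, evaluated from the left. -/
def bimp (a b : Bool) : Bool := Bool.rec true b a

/-- Evaluate `n` to a literal before passing it to `k`. -/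
def force {α : Type} (n : Nat) (k : Nat → α) : α :=
  Nat.rec (k 0) (fun m _ => k m) (Nat.add n 1)

/-- All members of `L` satisfy `p`. -/
def allL (p : Nat → Bool) (L : List Nat) : Bool := List.rec true (fun x _ ih => band (p x) ih) L

/-- Some member of `L` satisfies `p`. -/
def anyL (p : Nat → Bool) (L : List Nat) : Bool :=
  List.rec false (fun x _ ih => bite (p x) true ih) L

/-- The sum of `f` over `L`. -/
def sumL (f : Nat → Nat) (L : List Nat) : Nat := List.rec 0 (fun x _ ih => Nat.add (f x) ih) L

/-- Pass the members of `L` satisfying `p`, in reverse order, to `k`. -/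
def filt {α : Type} (p : Nat → Bool) (L : List Nat) (k : List Nat → α) : α :=
  @List.rec Nat (fun _ => List Nat → α) (fun acc => k acc)
    (fun u _ ih acc => bite (p u) (ih (u :: acc)) (ih acc)) L []

/-- The codes of the points of `Fin 8`. -/
def points : List Nat := [0, 6, 12, 18, 24, 30, 36, 42]

/-- The image of the point `x` under the permutation coded by `w`. -/
def app (w x : Nat) : Nat := Nat.land (Nat.shiftRight w x) 63

/-- The products `a * b` and `c * d` agree at the point `x`. -/
def eqAt (a b c d x : Nat) : Bool := Nat.beq (app a (app b x)) (app c (app d x))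

/-- The products `a * b` and `c * d` agree. -/
def eqc (a b c d : Nat) : Bool :=
  band (eqAt a b c d 0) (band (eqAt a b c d 6) (band (eqAt a b c d 12) (band (eqAt a b c d 18)
   (band (eqAt a b c d 24) (band (eqAt a b c d 30) (band (eqAt a b c d 36) (eqAt a b c d 42)))))))

/-- The key of the permutation coded by `c`: its number of moved points, counted with weight
eight for points in two-cycles and nine otherwise. -/
def keyc (c : Nat) : Nat :=
  sumL (fun x => bite (Nat.beq (app c x) x) 0
    (bite (Nat.beq (app c (app c x)) x) 8 9)) points

/-- The code of the conjugate of `r` by `p`. -/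
def conjc (p r : Nat) : Nat :=
  Nat.add (sumL (fun x => Nat.shiftLeft (app p (app r x)) (app p x)) points)
    (Nat.shiftLeft (Nat.shiftRight r 48) 48)

/-- Mark the code `c` by a leading bit if its key is `K`. -/
def flagged (K c : Nat) : Nat := bite (Nat.beq (keyc c) K) (Nat.add c 281474976710656) c

/-- The assignments `z ↦ w` and `y ↦ u`, together with those in `A`, violate no instance of
self-distributivity that they determine. -/
def okE (A : List (Nat × Nat)) (z w y u : Nat) : Bool :=
  band (bimp (Nat.beq (app u z) z) (eqc u w w u)) <|
  band (bimp (Nat.beq (app w y) y) (eqc u w w u)) <|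
  List.rec true (fun t _ ih => Prod.rec (fun x r =>
    band (bimp (Nat.beq (app w y) x) (eqc r w w u)) <|
    band (bimp (Nat.beq (app w x) y) (eqc u w w r)) <|
    band (bimp (Nat.beq (app r z) y) (eqc u r r w)) <|
    band (bimp (Nat.beq (app r y) z) (eqc w r r u)) <|
    band (bimp (Nat.beq (app u z) x) (eqc r u u w)) <|
    band (bimp (Nat.beq (app u x) z) (eqc w u u r)) ih) t) A

/-- Return `0` if `L` is empty, and `n` otherwise. -/
def guardNonempty (L : List Nat) (n : Nat) : Nat := List.rec 0 (fun _ _ _ => n) L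

/-- Restrict the domains in `D` after the assignment `z ↦ w`; return `0` if one becomes empty. -/
def newD (A : List (Nat × Nat)) (z w : Nat) (D : List (Nat × List Nat))
    (k : List (Nat × List Nat) → Nat) : Nat :=
  @List.rec (Nat × List Nat) (fun _ => (List (Nat × List Nat) → Nat) → Nat) (fun k => k [])
   (fun d _ ih k => Prod.rec (fun y L => filt (okE A z w y) L (fun L' =>
     guardNonempty L' (ih (fun D' => k ((y, L') :: D'))))) d) D k

/-- The weighted number of completions of the assignment `A`, where `D` lists the candidates for
the remaining points and `c` counts the marked translations chosen so far. -/
def search (n : Nat) (A : List (Nat × Nat)) (D : List (Nat × List Nat)) (c : Nat) : Nat :=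
  @Nat.rec (fun _ => List (Nat × Nat) → List (Nat × List Nat) → Nat → Nat)
   (fun _ _ c => Nat.div 840 c)
   (fun _ ih A D c => List.rec (Nat.div 840 c) (fun d D _ => Prod.rec (fun z L =>
      sumL (fun w => newD A z w D (fun D' =>
        ih ((z, w) :: A) D' (Nat.add c (Nat.shiftRight w 48)))) L) d) D) n A D c

/-- Look up the point `c` in the assignment `A`. -/
def lookup {α : Type} (A : List (Nat × Nat)) (c : Nat) (none : α) (some : Nat → α) : α :=
  List.rec none (fun t _ ih => Prod.rec (fun x r => bite (Nat.beq x c) (some r) ih) t) A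

/-- Record that the translation of the image of `b` under `p` is the conjugate of `r` by `p`: check
this if `A` has that translation, and otherwise add it to the queue `q`. -/
def oblige (p b r : Nat) (A : List (Nat × Nat)) (q : List (Nat × Nat × Nat))
    (k : List (Nat × Nat × Nat) → Bool) : Bool :=
  force (app p b) (fun c => lookup A c (k ((p, b, r) :: q)) (fun s => band (eqc s p p r) (k q)))

/-- Queue the consequences of the new assignment `c ↦ v` and those in `A`. -/
def push (c v : Nat) (A B : List (Nat × Nat)) (q : List (Nat × Nat × Nat))
    (k : List (Nat × Nat × Nat) → Bool) : Bool :=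
  @List.rec (Nat × Nat) (fun _ => List (Nat × Nat × Nat) → Bool) (fun q => k q)
    (fun t _ ih q => Prod.rec (fun x s =>
      oblige v x s B q (fun q => oblige s c v B q (fun q => ih q))) t) A q

/-- Process up to `n` entries of the queue `q`; the result is `false` on a contradiction. -/
def closure (n : Nat) (A : List (Nat × Nat)) (q : List (Nat × Nat × Nat)) : Bool :=
  @Nat.rec (fun _ => List (Nat × Nat) → List (Nat × Nat × Nat) → Bool) (fun _ _ => true)
    (fun _ ih A q => List.rec true (fun o q _ => Prod.rec (fun p o => Prod.rec (fun b r =>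
      force (app p b) (fun c => lookup A c
        (force (conjc p r) (fun v => push c v A ((c, v) :: A) q (fun q => ih ((c, v) :: A) q)))
        (fun s => band (eqc s p p r) (ih A q)))) o) o) q) n A q

/-- The code of the product of `a` and `b`. -/
def compc (a b : Nat) : Nat := sumL (fun x => Nat.shiftLeft (app a (app b x)) x) points

/-- Pass the first power of `s` that fixes `z`, starting from `t`, to `k`. -/
def stab {α : Type} (n s z t : Nat) (k : Nat → α) : α :=
  @Nat.rec (fun _ => Nat → α) (fun _ => k 187224474304896)
    (fun _ ih t => bite (Nat.beq (app t z) z) (k t) (force (compc s t) ih)) n t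

/-- The choice of the image `v` of `x` is consistent with the images in `c` of smaller points, for a
permutation commuting with `t`. -/
def prune (t x v c : Nat) : Bool :=
  band (bite (Nat.beq (app t x) x) (Nat.beq (app t v) v)
     (bite (Nat.beq (app t v) v) false
       (bimp (Nat.ble (app t x) x) (Nat.beq (app t v) (app c (app t x))))))
   (bimp (bite (Nat.beq x 0) false (Nat.beq (app t (Nat.sub x 6)) x))
     (Nat.beq v (app t (app c (Nat.sub x 6)))))

/-- No contradiction follows from the assignments `0 ↦ s` and `z ↦ c`. -/
def plausible (s z c : Nat) : Bool :=
  band (okE [] 0 s z c) (closure 40 [(z, c), (0, s)] [(s, z, c), (c, 0, s)])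

/-- Candidates for the translation of `z`: permutations that commute with `t`, have key at most `K`,
and extend the partial code `c` by mapping the points in `xs` to those in `rem`. -/
def gen (K s t z : Nat) (xs : List Nat) (rem : List Nat) (m c : Nat) (rest : List Nat) :
    List Nat :=
  @List.rec Nat (fun _ => List Nat → Nat → Nat → List Nat → List Nat)
   (fun _ _ c rest => force (flagged K c) (fun c =>
      bite (band (Nat.ble (keyc c) K) (plausible s z c)) (c :: rest) rest))
   (fun x _ ihx rem m c rest =>
     @List.rec Nat (fun _ => List Nat) rest
      (fun v _ ihv => bite (prune t x v c)
        (force (bite (Nat.beq v x) m (Nat.add m 8)) (fun m' => bite (Nat.ble m' K)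
         (force (Nat.add c (Nat.shiftLeft v x)) (fun c' =>
          filt (fun t => bite (Nat.beq t v) false true) rem (fun rem' =>
            ihx rem' m' c' ihv))) ihv)) ihv) rem)
   xs rem m c rest

/-- Pass the conjugates by `s` of the members of `L` to `k`. -/
def mapConj (s : Nat) (L : List Nat) (k : List Nat → Nat) : Nat :=
  @List.rec Nat (fun _ => List Nat → Nat) (fun acc => k acc)
    (fun u _ ih acc => force (conjc s u) (fun v => ih (v :: acc))) L []

/-- The number `c` is a valid code of a permutation with key at most `K` that fixes `z`. -/
def isItem (K z c : Nat) : Bool :=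
  band (Nat.ble (keyc c) K) <| band (Nat.beq (app c z) z) <|
  band (force (sumL (fun x => Nat.shiftLeft (app c x) x) points) (fun d =>
    force (flagged K d) (fun d => Nat.beq d c))) <|
  allL (fun y => anyL (fun x => Nat.beq (app c x) y) points) points

/-- Pass the members of `L` without repetitions to `k`. -/
def dedup (L : List Nat) (k : List Nat → Nat) : Nat :=
  @List.rec Nat (fun _ => List Nat → Nat) (fun acc => k acc)
    (fun u _ ih acc => bite (anyL (fun v => Nat.beq u v) acc) (ih acc) (ih (u :: acc))) L []

/-- Candidates for the translation of `z`, obtained by conjugation with `h` from those in `pL` for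
`pz` if possible, and generated from scratch otherwise. -/
def mkDom (K s z h pz : Nat) (pL : List Nat) (k : List Nat → Nat) : Nat :=
  bite (band (Nat.beq (app h pz) z) (band (isItem 1000 0 h) (eqc h s s h))) (mapConj h pL k)
   (filt (fun t => bite (Nat.beq t z) false true) points (fun rem =>
     stab 7 s z s (fun t => k (gen K s t z rem.reverse rem 0 (Nat.shiftLeft z z) []))))

/-- The candidates for the translations of all points in `zs`. -/
def doms (K s : Nat) (zs : List (Nat × Nat)) (pz : Nat) (pL : List Nat)
    (k : List (Nat × List Nat) → Nat) : Nat :=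
  @List.rec (Nat × Nat) (fun _ => Nat → List Nat → (List (Nat × List Nat) → Nat) → Nat)
   (fun _ _ k => k [])
   (fun zh _ ih pz pL k => Prod.rec (fun z h => mkDom K s z h pz pL (fun L =>
     filt (fun c => band (isItem K z c) (okE [] 0 s z c)) L (fun L => dedup L (fun L =>
      ih z L (fun D => k ((z, L) :: D)))))) zh) zs pz pL k

/-- The weighted number of quandles in which the translation of `0` is coded by `s`. -/
def run (s : Nat) (zs : List (Nat × Nat)) : Nat :=
  force (keyc s) (fun K => force (flagged K s) (fun s =>
    doms K s zs 0 [s] (fun D => search 7 [(0, s)] D 1)))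

theorem bite_eq {α : Type} (c : Bool) (t e : α) : bite c t e = if c then t else e := by
  cases c <;> rfl

theorem band_eq (a b : Bool) : band a b = (a && b) := by
  cases a <;> rfl

theorem bimp_eq_true (a b : Bool) : bimp a b = true ↔ (a = true → b = true) := by
  cases a <;> simp [bimp]

theorem force_eq {α : Type} (n : Nat) (k : Nat → α) : force n k = k n := by
  cases n <;> rfl

theorem shiftLeft_eq (a b : Nat) : Nat.shiftLeft a b = a <<< b := rfl

theorem add_eq (a b : Nat) : Nat.add a b = a + b := rfl

theorem shiftRight_eq (a b : Nat) : Nat.shiftRight a b = a / 2 ^ b := Nat.shiftRight_eq_div_pow a b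

theorem app_eq (w x : Nat) : app w x = w / 2 ^ x % 2 ^ 6 := by
  rw [← Nat.and_two_pow_sub_one_eq_mod, ← shiftRight_eq]; rfl

theorem beq_eq (a b : Nat) : Nat.beq a b = true ↔ a = b := Nat.beq_eq ▸ Iff.rfl

theorem allL_eq_true (p : Nat → Bool) (L : List Nat) : allL p L = true ↔ ∀ x ∈ L, p x = true := by
  induction L with
  | nil => simp [allL]
  | cons x L ih =>
    rw [show allL p (x :: L) = band (p x) (allL p L) from rfl, band_eq]
    simp [ih]

theorem anyL_eq_true (p : Nat → Bool) (L : List Nat) : anyL p L = true ↔ ∃ x ∈ L, p x = true := by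
  induction L with
  | nil => simp [anyL]
  | cons x L ih =>
    rw [show anyL p (x :: L) = bite (p x) true (anyL p L) from rfl, bite_eq]
    by_cases h : p x = true <;> simp [ih, h]

theorem sumL_eq (f : Nat → Nat) (L : List Nat) : sumL f L = (L.map f).sum := by
  induction L with
  | nil => rfl
  | cons x L ih =>
    rw [show sumL f (x :: L) = f x + sumL f L from rfl, ih]
    simp

theorem filt_eq {α : Type} (p : Nat → Bool) (L : List Nat) (k : List Nat → α) :
    filt p L k = k (L.filter p).reverse := by
  have h : ∀ acc : List Nat, @List.rec Nat (fun _ => List Nat → α) (fun acc => k acc)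
      (fun u _ ih acc => bite (p u) (ih (u :: acc)) (ih acc)) L acc =
      k ((L.filter p).reverse ++ acc) := by
    induction L with
    | nil => intro acc; simp
    | cons x L ih =>
      intro acc
      refine (bite_eq _ _ _).trans ?_
      rw [ih, ih]
      by_cases h : p x = true <;> simp [h]
  simpa [filt] using h []

/-- The bit offset of the digit storing the image of `i`. -/
def pos (i : Fin 8) : Nat := 6 * i

theorem pos_injective : Function.Injective pos := by
  intro i j h
  simp only [pos] at h
  omega

theorem pos_inj {i j : Fin 8} : pos i = pos j ↔ i = j := pos_injective.eq_iff

theorem points_eq : points = (List.finRange 8).map pos := by decide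

theorem mem_points {x : Nat} : x ∈ points ↔ ∃ i, pos i = x := by
  simp [points_eq]

theorem sumL_points (f : Nat → Nat) : sumL f points = ∑ i, f (pos i) := by
  rw [sumL_eq, points_eq, List.map_map, ← List.ofFn_eq_map, List.sum_ofFn]
  rfl

/-- The number with base-64 digits `d`, followed by the leading part `f`. -/
@[irreducible] def pack (d : Fin 8 → Nat) (f : Nat) : Nat := ∑ i, d i <<< pos i + f <<< 48

theorem app_pack (d : Fin 8 → Nat) (hd : ∀ i, d i < 64) (f : Nat) (i : Fin 8) :
    app (pack d f) (pos i) = d i := by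
  rw [app_eq]
  simp only [pack, Fin.sum_univ_eight, Nat.shiftLeft_eq]
  have h0 := hd 0
  have h1 := hd 1
  have h2 := hd 2
  have h3 := hd 3
  have h4 := hd 4
  have h5 := hd 5
  have h6 := hd 6
  have h7 := hd 7
  fin_cases i <;> simp [pos] <;> omega

theorem shiftRight_pack (d : Fin 8 → Nat) (hd : ∀ i, d i < 64) (f : Nat) :
    Nat.shiftRight (pack d f) 48 = f := by
  rw [shiftRight_eq]
  simp only [pack, Fin.sum_univ_eight, Nat.shiftLeft_eq]
  have h0 := hd 0
  have h1 := hd 1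
  have h2 := hd 2
  have h3 := hd 3
  have h4 := hd 4
  have h5 := hd 5
  have h6 := hd 6
  have h7 := hd 7
  simp [pos]
  omega

/-- A conjugation invariant measure of how far a permutation is from the identity. -/
def key (p : Perm (Fin 8)) : Nat := ∑ i, if p i = i then 0 else if p (p i) = i then 8 else 9

theorem key_conj (g p : Perm (Fin 8)) : key (g * p * g⁻¹) = key p := by
  rw [key, ← Equiv.sum_comp g]
  simp [key]

/-- The code of a permutation; the leading bit marks the permutations with key `K`. -/
def enc (K : Nat) (p : Perm (Fin 8)) : Nat :=
  pack (fun i => pos (p i)) (if key p = K then 1 else 0)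

/-- The digits of `c` are those of the code of `p`. -/
def Rep (c : Nat) (p : Perm (Fin 8)) : Prop := ∀ i, app c (pos i) = pos (p i)

theorem pos_lt (i : Fin 8) : pos i < 64 := by
  simp only [pos]; omega

theorem rep_enc (K : Nat) (p : Perm (Fin 8)) : Rep (enc K p) p :=
  app_pack _ (fun _ => pos_lt _) _

theorem Rep.unique {c : Nat} {p q : Perm (Fin 8)} (hp : Rep c p) (hq : Rep c q) : p = q :=
  Equiv.ext fun i => pos_injective ((hp i).symm.trans (hq i))

theorem enc_injective (K : Nat) : Function.Injective (enc K) := by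
  intro p q h
  exact (rep_enc K p).unique (h ▸ rep_enc K q)

theorem shiftRight_enc (K : Nat) (p : Perm (Fin 8)) :
    Nat.shiftRight (enc K p) 48 = if key p = K then 1 else 0 :=
  shiftRight_pack _ (fun _ => pos_lt _) _

theorem keyc_eq {c : Nat} {p : Perm (Fin 8)} (h : Rep c p) : keyc c = key p := by
  rw [keyc, sumL_points, key]
  refine Finset.sum_congr rfl fun i _ => ?_
  simp only [bite_eq, beq_eq, h _, pos_inj]

theorem eqc_eq_true {a b c d : Nat} {A B C D : Perm (Fin 8)} (ha : Rep a A) (hb : Rep b B)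
    (hc : Rep c C) (hd : Rep d D) : eqc a b c d = true ↔ A * B = C * D := by
  have h : ∀ i, eqAt a b c d (pos i) = true ↔ (A * B) i = (C * D) i := by
    intro i
    simp only [eqAt, beq_eq, ha _, hb _, hc _, hd _, pos_inj, Perm.mul_apply]
  have e : eqc a b c d = true ↔ ∀ i, eqAt a b c d (pos i) = true := by
    simp only [eqc, band_eq, Bool.and_eq_true, Fin.forall_fin_succ, IsEmpty.forall_iff, and_true]
    rfl
  rw [e, Equiv.ext_iff]
  exact forall_congr' h

theorem sum_digits {c : Nat} {p : Perm (Fin 8)} (h : Rep c p) :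
    sumL (fun x => Nat.shiftLeft (app c x) x) points = pack (fun i => pos (p i)) 0 := by
  rw [sumL_points, pack]
  simp only [h _, shiftLeft_eq, Nat.zero_shiftLeft, add_zero]

theorem pack_eq_add (d : Fin 8 → Nat) (f : Nat) : pack d f = pack d 0 + f <<< 48 := by
  rw [pack, pack, Nat.zero_shiftLeft, add_zero]

theorem flagged_pack (K : Nat) (p : Perm (Fin 8)) :
    flagged K (pack (fun i => pos (p i)) 0) = enc K p := by
  have hk : keyc (pack (fun i => pos (p i)) 0) = key p := keyc_eq (app_pack _ (fun _ => pos_lt _) _)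
  have e : 281474976710656 = 1 <<< 48 := by decide
  rw [flagged, hk, bite_eq, enc, pack_eq_add _ (ite _ _ _), add_eq, e]
  by_cases h : key p = K
  · rw [if_pos ((beq_eq _ _).mpr h), if_pos h]
  · rw [if_neg (fun h' => h ((beq_eq _ _).mp h')), if_neg h, Nat.zero_shiftLeft, add_zero]

theorem pack_conj {K a : Nat} {p r : Perm (Fin 8)} (h : Rep a p) :
    sumL (fun x => Nat.shiftLeft (app a (app (enc K r) x)) (app a x)) points =
      pack (fun i => pos ((p * r * p⁻¹) i)) 0 := by
  rw [sumL_points, pack, Nat.zero_shiftLeft, add_zero,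
    ← Equiv.sum_comp p (fun i => pos ((p * r * p⁻¹) i) <<< pos i)]
  refine Finset.sum_congr rfl fun i _ => ?_
  rw [rep_enc, h, h, shiftLeft_eq]
  simp

theorem conjc_enc {K a : Nat} {p r : Perm (Fin 8)} (h : Rep a p) :
    conjc a (enc K r) = enc K (p * r * p⁻¹) := by
  have e : enc K (p * r * p⁻¹) = pack (fun i => pos ((p * r * p⁻¹) i)) 0 +
      (if key r = K then 1 else 0) <<< 48 := by
    rw [enc, pack_eq_add, key_conj]
  rw [e, ← shiftRight_enc, ← pack_conj h (K := K)]
  exact add_eq _ _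

theorem rep_compc {a b : Nat} {p q : Perm (Fin 8)} (hp : Rep a p) (hq : Rep b q) :
    Rep (compc a b) (p * q) := by
  have : compc a b = pack (fun i => pos ((p * q) i)) 0 := by
    rw [compc, sumL_points, pack]
    simp only [hp _, hq _, shiftLeft_eq, Nat.zero_shiftLeft, add_zero, Perm.mul_apply]
  rw [this]
  exact app_pack _ (fun _ => pos_lt _) _

theorem rep_one : Rep 187224474304896 1 := by
  intro i
  fin_cases i <;> decide

theorem isItem_enc {K : Nat} {z : Fin 8} {p : Perm (Fin 8)} (hz : p z = z) (hK : key p ≤ K) :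
    isItem K (pos z) (enc K p) = true := by
  have h := rep_enc K p
  simp only [isItem, band_eq, Bool.and_eq_true, force_eq, keyc_eq h, sum_digits h, flagged_pack,
    beq_eq, h _, hz, Nat.ble_eq, hK, allL_eq_true, anyL_eq_true, true_and, mem_points]
  rintro _ ⟨y, rfl⟩
  exact ⟨_, ⟨p.symm y, rfl⟩, by simp [h _]⟩

theorem exists_of_isItem {K c : Nat} {z : Fin 8} (h : isItem K (pos z) c = true) :
    ∃ p : Perm (Fin 8), p z = z ∧ key p ≤ K ∧ c = enc K p := by
  simp only [isItem, band_eq, Bool.and_eq_true, force_eq, beq_eq, Nat.ble_eq, allL_eq_true,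
    anyL_eq_true, mem_points] at h
  obtain ⟨hK, hz, hc, hs⟩ := h
  have hs' : ∀ y, ∃ x, app c (pos x) = pos y := fun y => by
    obtain ⟨_, ⟨x, rfl⟩, hx⟩ := hs _ ⟨y, rfl⟩
    exact ⟨x, hx⟩
  choose g hg using hs'
  have hinj : Function.Injective g := fun y y' e => pos_injective (by rw [← hg, e, hg])
  let p := (Equiv.ofBijective g (Finite.injective_iff_bijective.mp hinj)).symm
  have hp : Rep c p := fun x => by
    have hx : g (p x) = x := (Equiv.ofBijective g _).apply_symm_apply x
    rw [← hg (p x), hx]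
  refine ⟨p, pos_injective (by rw [← hp, hz]), by rwa [← keyc_eq hp], ?_⟩
  rw [← hc, sum_digits hp, flagged_pack]

/-- The right translations of a quandle structure. -/
def IsQ (R : Fin 8 → Perm (Fin 8)) : Prop :=
  (∀ i, R i i = i) ∧ ∀ i j, R (R i j) * R i = R i * R j

/-- Quandles with keys at most `K` whose translations are prescribed by `A`. -/
def Ext (K : Nat) (A : List (Fin 8 × Perm (Fin 8))) (R : Fin 8 → Perm (Fin 8)) : Prop :=
  IsQ R ∧ (∀ i, key (R i) ≤ K) ∧ ∀ t ∈ A, R t.1 = t.2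

open Classical in
/-- The number of completions of `A`, each weighted by the number of its maximal keys. -/
noncomputable def wt (K : Nat) (A : List (Fin 8 × Perm (Fin 8))) : Nat :=
  ∑ R with Ext K A R, 840 / Finset.card {i | key (R i) = K}

/-- A consistent partial assignment of translations. -/
def Good (K : Nat) (A : List (Fin 8 × Perm (Fin 8))) : Prop :=
  (A.map Prod.fst).Nodup ∧ (∀ t ∈ A, t.2 t.1 = t.1 ∧ key t.2 ≤ K) ∧
  ∀ a ∈ A, ∀ b ∈ A, ∀ c ∈ A, a.2 b.1 = c.1 → c.2 * a.2 = a.2 * b.2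

/-- The constraints tested by `okE`. -/
def Compat (A : List (Fin 8 × Perm (Fin 8))) (z : Fin 8) (w : Perm (Fin 8)) (y : Fin 8)
    (u : Perm (Fin 8)) : Prop :=
  (u z = z → u * w = w * u) ∧ (w y = y → u * w = w * u) ∧ ∀ t ∈ A,
    (w y = t.1 → t.2 * w = w * u) ∧ (w t.1 = y → u * w = w * t.2) ∧
    (t.2 z = y → u * t.2 = t.2 * w) ∧ (t.2 y = z → w * t.2 = t.2 * u) ∧
    (u z = t.1 → t.2 * u = u * w) ∧ (u t.1 = z → w * u = u * t.2)

def encItem (K : Nat) (t : Fin 8 × Perm (Fin 8)) : Nat × Nat := (pos t.1, enc K t.2)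

def encDom (K : Nat) (d : Fin 8 × List (Perm (Fin 8))) : Nat × List Nat :=
  (pos d.1, d.2.map (enc K))

theorem okE_eq_true {K : Nat} {A : List (Fin 8 × Perm (Fin 8))} {z : Fin 8} {w : Perm (Fin 8)}
    {y : Fin 8} {u : Perm (Fin 8)} :
    okE (A.map (encItem K)) (pos z) (enc K w) (pos y) (enc K u) = true ↔ Compat A z w y u := by
  have hE : ∀ p q r s, eqc (enc K p) (enc K q) (enc K r) (enc K s) = true ↔ p * q = r * s :=
    fun p q r s => eqc_eq_true (rep_enc _ _) (rep_enc _ _) (rep_enc _ _) (rep_enc _ _)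
  have hA : ∀ (p : Perm (Fin 8)) i, app (enc K p) (pos i) = pos (p i) := fun p => rep_enc K p
  rw [okE, Compat]
  simp only [band_eq, Bool.and_eq_true, bimp_eq_true, hE, hA, beq_eq, pos_inj]
  refine and_congr_right' (and_congr_right' ?_)
  induction A with
  | nil => simp
  | cons t A ih =>
    simp only [List.map_cons, List.forall_mem_cons]
    rw [← ih]
    simp only [encItem, Bool.and_eq_true, bimp_eq_true, hE, hA, beq_eq, pos_inj]
    tauto

theorem Ext.compat {K : Nat} {A : List (Fin 8 × Perm (Fin 8))} {z : Fin 8} {w : Perm (Fin 8)}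
    {R : Fin 8 → Perm (Fin 8)} (h : Ext K ((z, w) :: A) R) (y : Fin 8) :
    Compat A z w y (R y) := by
  obtain ⟨⟨hi, hq⟩, -, hA⟩ := h
  simp only [List.forall_mem_cons] at hA
  obtain ⟨rfl, hA⟩ := hA
  refine ⟨fun e => ?_, fun e => ?_, fun t ht => ?_⟩
  · have := hq y z
    rw [e] at this
    exact this.symm
  · have := hq z y
    rwa [e] at this
  · rw [← hA t ht]
    refine ⟨fun e => ?_, fun e => ?_, fun e => ?_, fun e => ?_, fun e => ?_, fun e => ?_⟩ <;>
    · rw [← e]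
      exact hq _ _

theorem Good.extend {K : Nat} {A : List (Fin 8 × Perm (Fin 8))} {z : Fin 8} {w : Perm (Fin 8)}
    {y : Fin 8} {u : Perm (Fin 8)} (hw : Good K ((z, w) :: A)) (hu : Good K ((y, u) :: A))
    (hne : y ≠ z) (hc : Compat A z w y u) : Good K ((y, u) :: (z, w) :: A) := by
  obtain ⟨nw, kw, tw⟩ := hw
  obtain ⟨nu, ku, tu⟩ := hu
  obtain ⟨c1, c2, c3⟩ := hc
  simp only [List.forall_mem_cons] at kw ku
  simp only [List.map_cons, List.nodup_cons] at nw nu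
  refine ⟨?_, ?_, ?_⟩
  · simp only [List.map_cons, List.nodup_cons, List.mem_cons, not_or]
    exact ⟨⟨hne, nu.1⟩, nw.1, nw.2⟩
  · simp only [List.forall_mem_cons]
    exact ⟨ku.1, kw.1, kw.2⟩
  · have wz : w z = z := kw.1.1
    have uy : u y = y := ku.1.1
    have wy : w y ≠ z := fun e => hne (w.injective (e.trans wz.symm))
    have uz : u z ≠ y := fun e => hne (u.injective (e.trans uy.symm)).symm
    intro a ha b hb c hc e
    by_cases h1 : a ∈ (z, w) :: A ∧ b ∈ (z, w) :: A ∧ c ∈ (z, w) :: A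
    · exact tw a h1.1 b h1.2.1 c h1.2.2 e
    by_cases h2 : a ∈ (y, u) :: A ∧ b ∈ (y, u) :: A ∧ c ∈ (y, u) :: A
    · exact tu a h2.1 b h2.2.1 c h2.2.2 e
    simp only [List.mem_cons] at ha hb hc h1 h2
    rcases ha with rfl | rfl | ha <;> rcases hb with rfl | rfl | hb <;>
      rcases hc with rfl | rfl | hc <;> try dsimp only at e ⊢
    all_goals first
      | exact absurd e wy
      | exact absurd e uz
      | exact absurd (w.injective (e.trans wz.symm)) hne
      | exact absurd (u.injective (e.trans uy.symm)) hne.symm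
      | exact c1 e
      | exact c2 e
      | exact (c1 e).symm
      | exact (c2 e).symm
      | exact (c3 _ hc).1 e
      | exact (c3 _ hb).2.1 e
      | exact (c3 _ ha).2.2.1 e
      | exact (c3 _ ha).2.2.2.1 e
      | exact (c3 _ hc).2.2.2.2.1 e
      | exact (c3 _ hb).2.2.2.2.2 e
      | exact absurd (uy.symm.trans e) hne
      | exact absurd (wz.symm.trans e) hne.symm
      | exact absurd ⟨by first | exact Or.inl rfl | exact Or.inr ‹_›,
          by first | exact Or.inl rfl | exact Or.inr ‹_›,
          by first | exact Or.inl rfl | exact Or.inr ‹_›⟩ h1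
      | exact absurd ⟨by first | exact Or.inl rfl | exact Or.inr ‹_›,
          by first | exact Or.inl rfl | exact Or.inr ‹_›,
          by first | exact Or.inl rfl | exact Or.inr ‹_›⟩ h2

open Classical in
/-- The restriction of a domain to the candidates compatible with a new assignment. -/
noncomputable def restrict (A : List (Fin 8 × Perm (Fin 8))) (z : Fin 8) (w : Perm (Fin 8))
    (d : Fin 8 × List (Perm (Fin 8))) : Fin 8 × List (Perm (Fin 8)) :=
  (d.1, (d.2.filter (Compat A z w d.1 ·)).reverse)

theorem newD_eq {K : Nat} {A : List (Fin 8 × Perm (Fin 8))} {z : Fin 8} {w : Perm (Fin 8)}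
    (D : List (Fin 8 × List (Perm (Fin 8)))) (k : List (Nat × List Nat) → Nat) :
    newD (A.map (encItem K)) (pos z) (enc K w) (D.map (encDom K)) k =
      if ∀ d ∈ D, (restrict A z w d).2 ≠ [] then k ((D.map (restrict A z w)).map (encDom K))
      else 0 := by
  classical
  induction D generalizing k with
  | nil => simp [newD]
  | cons d D ih =>
    have e : newD (A.map (encItem K)) (pos z) (enc K w) ((d :: D).map (encDom K)) k =
      filt (okE (A.map (encItem K)) (pos z) (enc K w) (pos d.1)) (d.2.map (enc K)) (fun L' =>
        guardNonempty L' (newD (A.map (encItem K)) (pos z) (enc K w) (D.map (encDom K))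
          (fun D' => k ((pos d.1, L') :: D')))) := rfl
    have hf : ((d.2.map (enc K)).filter
        (okE (A.map (encItem K)) (pos z) (enc K w) (pos d.1))).reverse =
        (restrict A z w d).2.map (enc K) := by
      rw [List.filter_map, restrict, List.map_reverse]
      congr 3
      funext u
      rw [Function.comp_apply, Bool.eq_iff_iff, okE_eq_true, decide_eq_true_iff]
    rw [e, filt_eq, hf, ih]
    simp only [List.forall_mem_cons]
    by_cases h : (restrict A z w d).2 = []
    · simp [h, guardNonempty]
    · obtain ⟨u, L, hL⟩ := List.exists_cons_of_ne_nil h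
      have hg : ∀ n, guardNonempty ((restrict A z w d).2.map (enc K)) n = n := by
        intro n; rw [hL]; rfl
      rw [hg]
      simp only [ne_eq, h, not_false_eq_true, true_and, List.map_cons]
      rfl

theorem ext_cons {K : Nat} {A : List (Fin 8 × Perm (Fin 8))} {z : Fin 8} {w : Perm (Fin 8)}
    {R : Fin 8 → Perm (Fin 8)} : Ext K ((z, w) :: A) R ↔ Ext K A R ∧ R z = w := by
  simp only [Ext, List.forall_mem_cons]
  tauto

theorem wt_branch {K : Nat} {A : List (Fin 8 × Perm (Fin 8))} {z : Fin 8}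
    {L : List (Perm (Fin 8))} (hL : L.Nodup) (h : ∀ R, Ext K A R → R z ∈ L) :
    wt K A = (L.map fun w => wt K ((z, w) :: A)).sum := by
  classical
  rw [← List.sum_toFinset _ hL, wt,
    ← Finset.sum_fiberwise_of_maps_to (t := L.toFinset) (g := fun R => R z)]
  · refine Finset.sum_congr rfl fun w _ => ?_
    rw [wt, Finset.filter_filter]
    simp only [ext_cons]
  · simp only [Finset.mem_filter, List.mem_toFinset]
    exact fun R hR => h R hR.2

theorem wt_of_cover {K : Nat} {A : List (Fin 8 × Perm (Fin 8))} (hA : Good K A)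
    (hc : ∀ i, i ∈ A.map Prod.fst) : wt K A = 840 / A.countP (fun t => key t.2 = K) := by
  classical
  obtain ⟨hn, hk, ht⟩ := hA
  simp only [List.mem_map] at hc
  choose f hf hfi using hc
  have hR : ∀ t ∈ A, (f t.1).2 = t.2 := fun t h => by
    rw [List.inj_on_of_nodup_map hn (hf t.1) h (hfi t.1)]
  have hE : Ext K A fun i => (f i).2 := by
    refine ⟨⟨fun i => ?_, fun i j => ?_⟩, fun i => (hk _ (hf i)).2, hR⟩
    · have := (hk _ (hf i)).1
      rwa [hfi] at this
    · exact ht _ (hf i) _ (hf j) _ (hf _) (by rw [hfi, hfi])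
  have hu : ∀ R, Ext K A R ↔ R = fun i => (f i).2 := by
    refine fun R => ⟨fun h => funext fun i => ?_, fun h => h ▸ hE⟩
    have := h.2.2 _ (hf i)
    rwa [hfi] at this
  rw [wt]
  simp only [hu, Finset.filter_eq', Finset.mem_univ, if_true, Finset.sum_singleton]
  congr 1
  have e : (Finset.univ : Finset (Fin 8)) = (A.map Prod.fst).toFinset := by
    ext i
    simpa using ⟨(f i).2, by have := hf i; rwa [← Prod.mk.eta (p := f i), hfi] at this⟩
  have e' : Finset.filter (fun i => key (f i).2 = K) (A.map Prod.fst).toFinset =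
      ((A.map Prod.fst).filter fun i => key (f i).2 = K).toFinset := by
    ext i
    simp only [Finset.mem_filter, List.mem_toFinset, List.mem_filter, decide_eq_true_iff]
  rw [e, e', List.toFinset_card_of_nodup (hn.filter _),
    ← List.countP_eq_length_filter, List.countP_map]
  refine List.countP_congr fun t h => ?_
  simp [hR t h]

/-- The invariants of the search. -/
structure SearchInv (K : Nat) (A : List (Fin 8 × Perm (Fin 8)))
    (D : List (Fin 8 × List (Perm (Fin 8)))) : Prop where
  good : Good K A
  nodup : (D.map Prod.fst).Nodup
  cover : ∀ i, i ∈ A.map Prod.fst ∨ i ∈ D.map Prod.fst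
  nodup_dom : ∀ d ∈ D, d.2.Nodup
  sound : ∀ d ∈ D, ∀ u ∈ d.2, Good K ((d.1, u) :: A)
  complete : ∀ d ∈ D, ∀ R, Ext K A R → R d.1 ∈ d.2

theorem SearchInv.cons {K : Nat} {A : List (Fin 8 × Perm (Fin 8))} {z : Fin 8}
    {L : List (Perm (Fin 8))} {D : List (Fin 8 × List (Perm (Fin 8)))}
    (h : SearchInv K A ((z, L) :: D)) {w : Perm (Fin 8)} (hw : w ∈ L) :
    SearchInv K ((z, w) :: A) (D.map (restrict A z w)) := by
  classical
  obtain ⟨hg, hn, hc, hd, hs, hcm⟩ := h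
  have e : (D.map (restrict A z w)).map Prod.fst = D.map Prod.fst := by
    rw [List.map_map]; rfl
  simp only [List.map_cons, List.nodup_cons, List.mem_cons] at hn hc
  simp only [List.forall_mem_cons] at hd hs hcm
  refine ⟨hs.1 w hw, by rw [e]; exact hn.2, ?_, ?_, ?_, ?_⟩
  · intro i
    rw [e, List.map_cons, List.mem_cons]
    have := hc i
    tauto
  · simp only [List.forall_mem_map, restrict, List.nodup_reverse]
    exact fun d h => (hd.2 d h).filter _
  · simp only [List.forall_mem_map, restrict, List.mem_reverse, List.mem_filter,
      decide_eq_true_iff]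
    intro d h u hu
    refine (hs.1 w hw).extend (hs.2 d h u hu.1) (fun e => hn.1 ?_) hu.2
    exact e ▸ List.mem_map_of_mem h
  · simp only [List.forall_mem_map, restrict, List.mem_reverse, List.mem_filter,
      decide_eq_true_iff]
    exact fun d h R hR => ⟨hcm.2 d h R (ext_cons.1 hR).1, hR.compat _⟩

theorem search_eq {K : Nat} (n : Nat) {A : List (Fin 8 × Perm (Fin 8))}
    {D : List (Fin 8 × List (Perm (Fin 8)))} (hD : D.length ≤ n) (h : SearchInv K A D) :
    search n (A.map (encItem K)) (D.map (encDom K)) (A.countP (fun t => key t.2 = K)) =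
      wt K A := by
  classical
  induction n generalizing A D with
  | zero =>
    obtain rfl : D = [] := List.length_eq_zero_iff.1 (Nat.le_zero.1 hD)
    rw [wt_of_cover h.good fun i => by simpa using h.cover i]
    rfl
  | succ n ih =>
    rcases D with _ | ⟨⟨z, L⟩, D⟩
    · rw [wt_of_cover h.good fun i => by simpa using h.cover i]
      rfl
    · have e : search (n + 1) (A.map (encItem K)) (((z, L) :: D).map (encDom K))
          (A.countP (fun t => key t.2 = K)) = sumL (fun w =>
            newD (A.map (encItem K)) (pos z) w (D.map (encDom K)) (fun D' =>
              search n ((pos z, w) :: A.map (encItem K)) D'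
                (Nat.add (A.countP (fun t => key t.2 = K)) (Nat.shiftRight w 48))))
            (L.map (enc K)) := rfl
      rw [e, sumL_eq, List.map_map, wt_branch (h.nodup_dom _ List.mem_cons_self)
        (h.complete _ List.mem_cons_self)]
      refine congrArg List.sum (List.map_congr_left fun w hw => ?_)
      have hi := h.cons hw
      rw [Function.comp_apply, newD_eq, shiftRight_enc, add_eq]
      split_ifs with h1 h2
      · rw [← ih (by simpa using hD) hi]
        simp [h2, encItem]
      · rw [← ih (by simpa using hD) hi]
        simp [h2, encItem]
      all_goals
        push Not at h1
        obtain ⟨d, hd, h0⟩ := h1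
        rw [wt, Finset.filter_eq_empty_iff.2, Finset.sum_empty]
        intro R _ hR
        have := hi.complete _ (List.mem_map_of_mem hd) R hR
        rw [h0] at this
        exact List.not_mem_nil this

theorem IsQ.map {R : Fin 8 → Perm (Fin 8)} (h : IsQ R) (i j : Fin 8) :
    R (R i j) = R i * R j * (R i)⁻¹ := by
  rw [← h.2 i j, mul_inv_cancel_right]

theorem lookup_eq {α : Type} (A : List (Nat × Nat)) (c : Nat) (none : α) (some : Nat → α) :
    lookup A c none some = none ∨ ∃ r, (c, r) ∈ A ∧ lookup A c none some = some r := by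
  induction A with
  | nil => exact Or.inl rfl
  | cons t A ih =>
    obtain ⟨x, r⟩ := t
    have e : lookup ((x, r) :: A) c none some =
      bite (Nat.beq x c) (some r) (lookup A c none some) := rfl
    rw [e, bite_eq]
    split_ifs with h
    · rw [beq_eq] at h
      exact Or.inr ⟨r, by simp [h], rfl⟩
    · refine ih.imp id fun ⟨r, hr, h⟩ => ⟨r, List.mem_cons_of_mem _ hr, h⟩

/-- The list `A` holds codes of translations of `R`. -/
def Known (K : Nat) (R : Fin 8 → Perm (Fin 8)) (A : List (Nat × Nat)) : Prop :=
  ∀ t ∈ A, ∃ i, t = (pos i, enc K (R i))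

/-- The list `q` holds pairs of translations of `R`. -/
def Pending (K : Nat) (R : Fin 8 → Perm (Fin 8)) (q : List (Nat × Nat × Nat)) : Prop :=
  ∀ o ∈ q, ∃ i j, o = (enc K (R i), pos j, enc K (R j))

theorem Known.eqc {K : Nat} {R : Fin 8 → Perm (Fin 8)} {A : List (Nat × Nat)}
    (hA : Known K R A) (hR : IsQ R) {i j : Fin 8} {s : Nat}
    (hs : (app (enc K (R i)) (pos j), s) ∈ A) :
    eqc s (enc K (R i)) (enc K (R i)) (enc K (R j)) = true := by
  obtain ⟨l, hl⟩ := hA _ hs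
  rw [Prod.mk.injEq, rep_enc, pos_inj] at hl
  rw [hl.2, ← hl.1]
  exact (eqc_eq_true (rep_enc _ _) (rep_enc _ _) (rep_enc _ _) (rep_enc _ _)).2 (hR.2 i j)

theorem oblige_eq_true {K : Nat} {R : Fin 8 → Perm (Fin 8)} {A : List (Nat × Nat)}
    (hA : Known K R A) (hR : IsQ R) (i j : Fin 8) {q : List (Nat × Nat × Nat)}
    (hq : Pending K R q) {k : List (Nat × Nat × Nat) → Bool}
    (hk : ∀ q, Pending K R q → k q = true) :
    oblige (enc K (R i)) (pos j) (enc K (R j)) A q k = true := by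
  rw [oblige, force_eq]
  obtain h | ⟨s, hs, h⟩ := lookup_eq A (app (enc K (R i)) (pos j))
    (k ((enc K (R i), pos j, enc K (R j)) :: q))
    (fun s => band (QuandleCount.eqc s (enc K (R i)) (enc K (R i)) (enc K (R j))) (k q))
  · rw [h]
    refine hk _ fun o ho => ?_
    rcases List.mem_cons.1 ho with rfl | ho
    · exact ⟨i, j, rfl⟩
    · exact hq o ho
  · rw [h, band_eq, hA.eqc hR hs, hk q hq]
    rfl

theorem push_eq_true {K : Nat} {R : Fin 8 → Perm (Fin 8)} {A B : List (Nat × Nat)}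
    (hA : Known K R A) (hB : Known K R B) (hR : IsQ R) (i : Fin 8)
    {q : List (Nat × Nat × Nat)} (hq : Pending K R q) {k : List (Nat × Nat × Nat) → Bool}
    (hk : ∀ q, Pending K R q → k q = true) :
    push (pos i) (enc K (R i)) A B q k = true := by
  induction A generalizing q with
  | nil => exact hk q hq
  | cons t A ih =>
    obtain ⟨j, rfl⟩ := hA t List.mem_cons_self
    exact oblige_eq_true hB hR i j hq fun q hq => oblige_eq_true hB hR j i hq fun q hq =>
      ih (fun t ht => hA t (List.mem_cons_of_mem _ ht)) hq

theorem closure_eq_true {K : Nat} {R : Fin 8 → Perm (Fin 8)} (hR : IsQ R) (n : Nat)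
    {A : List (Nat × Nat)} (hA : Known K R A) {q : List (Nat × Nat × Nat)}
    (hq : Pending K R q) : closure n A q = true := by
  induction n generalizing A q with
  | zero => rfl
  | succ n ih =>
    rcases q with _ | ⟨o, q⟩
    · rfl
    obtain ⟨i, j, rfl⟩ := hq o List.mem_cons_self
    have hq' : Pending K R q := fun o ho => hq o (List.mem_cons_of_mem _ ho)
    have e : closure (n + 1) A ((enc K (R i), pos j, enc K (R j)) :: q) =
      force (app (enc K (R i)) (pos j)) (fun c => lookup A c
        (force (conjc (enc K (R i)) (enc K (R j))) (fun v => push c v A ((c, v) :: A) q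
          (fun q => closure n ((c, v) :: A) q)))
        (fun s => band (eqc s (enc K (R i)) (enc K (R i)) (enc K (R j))) (closure n A q))) := rfl
    rw [e, force_eq, force_eq]
    obtain h | ⟨s, hs, h⟩ := lookup_eq A (app (enc K (R i)) (pos j))
      (push (app (enc K (R i)) (pos j)) (conjc (enc K (R i)) (enc K (R j))) A
        ((app (enc K (R i)) (pos j), conjc (enc K (R i)) (enc K (R j))) :: A) q
        (fun q => closure n
          ((app (enc K (R i)) (pos j), conjc (enc K (R i)) (enc K (R j))) :: A) q))
      (fun s => band (eqc s (enc K (R i)) (enc K (R i)) (enc K (R j))) (closure n A q))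
    · rw [h, conjc_enc (rep_enc _ _), rep_enc, ← hR.map]
      have hB : Known K R ((pos (R i j), enc K (R (R i j))) :: A) := by
        intro t ht
        rcases List.mem_cons.1 ht with rfl | ht
        · exact ⟨_, rfl⟩
        · exact hA t ht
      exact push_eq_true hA hB hR _ hq' fun q hq => ih hB hq
    · rw [h, band_eq, hA.eqc hR hs, ih hA hq']
      rfl

theorem pos_zero : pos 0 = 0 := rfl

theorem plausible_eq_true {K : Nat} {σ : Perm (Fin 8)} {R : Fin 8 → Perm (Fin 8)}
    (hR : Ext K [(0, σ)] R) (z : Fin 8) :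
    plausible (enc K σ) (pos z) (enc K (R z)) = true := by
  have h0 : R 0 = σ := hR.2.2 (0, σ) List.mem_cons_self
  rw [plausible, band_eq, Bool.and_eq_true]
  constructor
  · have := okE_eq_true (K := K) (A := []) (z := 0) (w := σ) (y := z) (u := R z)
    rw [List.map_nil, pos_zero] at this
    exact this.2 (hR.compat z)
  · rw [← h0]
    refine closure_eq_true hR.1 _ (K := K) ?_ ?_
    · rw [Known]
      simp only [List.forall_mem_cons]
      exact ⟨⟨z, rfl⟩, ⟨0, rfl⟩, fun _ h => absurd h List.not_mem_nil⟩
    · rw [Pending]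
      simp only [List.forall_mem_cons]
      exact ⟨⟨0, z, rfl⟩, ⟨z, 0, rfl⟩, fun _ h => absurd h List.not_mem_nil⟩

theorem stab_eq {α : Type} {σ : Perm (Fin 8)} {s : Nat} (hs : Rep s σ) (n : Nat) (z : Fin 8)
    {t : Nat} {m : Nat} (ht : Rep t (σ ^ m)) :
    ∃ (c j : Nat), Rep c (σ ^ j) ∧ (σ ^ j) z = z ∧
      ∀ k : Nat → α, stab n s (pos z) t k = k c := by
  induction n generalizing t m with
  | zero => exact ⟨_, 0, rep_one, rfl, fun k => rfl⟩
  | succ n ih =>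
    have e : ∀ k : Nat → α, stab (n + 1) s (pos z) t k =
      bite (Nat.beq (app t (pos z)) (pos z)) (k t)
        (force (compc s t) (fun t => stab n s (pos z) t k)) := fun k => rfl
    by_cases h : (σ ^ m) z = z
    · exact ⟨t, m, ht, h, fun k => by rw [e, bite_eq, if_pos (by rw [beq_eq, ht, h])]⟩
    · have hc := rep_compc hs ht
      rw [← pow_succ'] at hc
      obtain ⟨c, j, hj, hz, hk⟩ := ih hc
      refine ⟨c, j, hj, hz, fun k => ?_⟩
      rw [e, bite_eq, if_neg (by rwa [beq_eq, ht, pos_inj]), force_eq, hk]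

theorem Ext.pow_comm {K : Nat} {σ : Perm (Fin 8)} {R : Fin 8 → Perm (Fin 8)}
    (hR : Ext K [(0, σ)] R) {z : Fin 8} {j : Nat} (hz : (σ ^ j) z = z) :
    σ ^ j * R z = R z * σ ^ j := by
  have h0 : R 0 = σ := hR.2.2 (0, σ) List.mem_cons_self
  have h : ∀ j z, R ((σ ^ j) z) * σ ^ j = σ ^ j * R z := by
    intro j
    induction j with
    | zero => simp
    | succ j ih =>
      intro z
      have := hR.1.2 0 ((σ ^ j) z)
      rw [h0] at this
      rw [pow_succ', Perm.mul_apply, ← mul_assoc, this, mul_assoc, ih, mul_assoc]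
  have := h j z
  rw [hz] at this
  exact this.symm

/-- The partial code of `u` with the digits of the points in `l` left blank. -/
def partialCode (u : Perm (Fin 8)) (l : List (Fin 8)) : Nat :=
  pack (fun i => if i ∈ l then 0 else pos (u i)) 0

theorem app_partialCode (u : Perm (Fin 8)) (l : List (Fin 8)) {i : Fin 8} (hi : i ∉ l) :
    app (partialCode u l) (pos i) = pos (u i) := by
  rw [partialCode, app_pack _ (fun j => ?_) _ _, if_neg hi]
  split_ifs
  · norm_num
  · exact pos_lt _

theorem partialCode_cons (u : Perm (Fin 8)) {l : List (Fin 8)} {i : Fin 8} (hi : i ∉ l) :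
    Nat.add (partialCode u (i :: l)) (Nat.shiftLeft (pos (u i)) (pos i)) = partialCode u l := by
  rw [add_eq, shiftLeft_eq, partialCode, partialCode, pack, pack, Nat.zero_shiftLeft,
    add_zero, add_zero, ← Finset.sum_erase_add _ _ (Finset.mem_univ i),
    ← Finset.sum_erase_add _ (fun j => (if j ∈ l then 0 else pos (u j)) <<< pos j)
      (Finset.mem_univ i), if_pos List.mem_cons_self, if_neg hi, Nat.zero_shiftLeft, add_zero]
  congr 1
  refine Finset.sum_congr rfl fun j hj => ?_
  simp only [List.mem_cons, Finset.ne_of_mem_erase hj, false_or]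

theorem prune_eq_true {t : Nat} {T u : Perm (Fin 8)} (ht : Rep t T) (hc : T * u = u * T)
    {i : Fin 8} {l : List (Fin 8)} (hl : ∀ j ∈ l, i < j) :
    prune t (pos i) (pos (u i)) (partialCode u (i :: l)) = true := by
  have hT : ∀ j, T (u j) = u (T j) := fun j => congrArg (· j) hc
  have hlt : ∀ j, j < i → app (partialCode u (i :: l)) (pos j) = pos (u j) := by
    refine fun j hj => app_partialCode u _ fun h => ?_
    rcases List.mem_cons.1 h with rfl | h
    · exact lt_irrefl _ hj
    · exact lt_asymm hj (hl j h)
  simp only [prune, band_eq, bite_eq, Bool.and_eq_true, bimp_eq_true, beq_eq, ht _, pos_inj]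
  constructor
  · by_cases h : T i = i
    · simp only [h, if_true, beq_eq, pos_inj]
      rw [hT, h]
    · have hu : T (u i) ≠ u i := by
        rw [hT]
        exact fun e => h (u.injective e)
      simp only [h, hu, if_false, bimp_eq_true, Nat.ble_eq, beq_eq]
      intro hle
      rw [hlt, hT]
      refine lt_of_le_of_ne ?_ h
      simp only [pos] at hle
      omega
  · split_ifs with h0
    · simp
    · intro h
      have hi : (i : Nat) ≠ 0 := fun e => h0 (by rw [pos, e])
      have hp : Nat.sub (pos i) 6 = pos ⟨i - 1, by omega⟩ := by
        simp only [pos, Nat.sub_eq]; omega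
      have hl : (⟨i - 1, by omega⟩ : Fin 8) < i := by
        rw [Fin.lt_def]; simp only; omega
      rw [hp, ht, beq_eq, pos_inj] at h
      rw [hp, hlt _ hl, ht, hT, h]

/-- The loop of `gen` over the possible images of the point `x`. -/
def branches (K t x : Nat) (next : List Nat → Nat → Nat → List Nat → List Nat)
    (rem : List Nat) (m c : Nat) (rest : List Nat) (vs : List Nat) : List Nat :=
  @List.rec Nat (fun _ => List Nat) rest
    (fun v _ ihv => bite (prune t x v c)
      (force (bite (Nat.beq v x) m (Nat.add m 8)) (fun m' => bite (Nat.ble m' K)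
        (force (Nat.add c (Nat.shiftLeft v x)) (fun c' =>
          filt (fun t => bite (Nat.beq t v) false true) rem (fun rem' =>
            next rem' m' c' ihv))) ihv)) ihv) vs

theorem branches_cons (K t x : Nat) (next : List Nat → Nat → Nat → List Nat → List Nat)
    (rem : List Nat) (m c : Nat) (rest : List Nat) (v : Nat) (vs : List Nat) :
    branches K t x next rem m c rest (v :: vs) =
      if prune t x v c ∧ (if v = x then m else m + 8) ≤ K then
        next (rem.filter (· ≠ v)).reverse (if v = x then m else m + 8)
          (Nat.add c (Nat.shiftLeft v x)) (branches K t x next rem m c rest vs)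
      else branches K t x next rem m c rest vs := by
  have e : branches K t x next rem m c rest (v :: vs) =
    bite (prune t x v c)
      (force (bite (Nat.beq v x) m (Nat.add m 8)) (fun m' => bite (Nat.ble m' K)
        (force (Nat.add c (Nat.shiftLeft v x)) (fun c' =>
          filt (fun t => bite (Nat.beq t v) false true) rem (fun rem' =>
            next rem' m' c' (branches K t x next rem m c rest vs))))
          (branches K t x next rem m c rest vs))) (branches K t x next rem m c rest vs) := rfl
  have hf : (fun t => bite (Nat.beq t v) false true) = (fun t => decide (t ≠ v)) := by
    funext t
    rw [bite_eq, Bool.eq_iff_iff, decide_eq_true_iff, ne_eq, ← beq_eq]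
    cases Nat.beq t v <;> simp
  rw [e, force_eq, force_eq, filt_eq, hf]
  simp only [bite_eq, beq_eq, Nat.ble_eq, add_eq]
  by_cases h1 : prune t x v c = true <;>
    by_cases h2 : (if v = x then m else m + 8) ≤ K <;> simp [h1, h2]

theorem gen_cons (K s t z x : Nat) (xs rem : List Nat) (m c : Nat) (rest : List Nat) :
    gen K s t z (x :: xs) rem m c rest =
      branches K t x (gen K s t z xs) rem m c rest rem := rfl

theorem gen_nil (K s t z : Nat) (rem : List Nat) (m c : Nat) (rest : List Nat) :
    gen K s t z [] rem m c rest =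
      if keyc (flagged K c) ≤ K ∧ plausible s z (flagged K c) then flagged K c :: rest
      else rest := by
  rw [show gen K s t z [] rem m c rest = force (flagged K c) (fun c =>
    bite (band (Nat.ble (keyc c) K) (plausible s z c)) (c :: rest) rest) from rfl, force_eq,
    bite_eq, band_eq]
  simp only [Bool.and_eq_true, Nat.ble_eq]

theorem ite_cases {α : Type} (p : α → Prop) {c : Prop} [Decidable c] {a b : α} (ha : c → p a)
    (hb : ¬c → p b) : p (if c then a else b) := by
  split_ifs with h
  · exact ha h
  · exact hb h

theorem branches_mono {K t x : Nat} {next : List Nat → Nat → Nat → List Nat → List Nat}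
    (hn : ∀ rem m c rest, rest ⊆ next rem m c rest) (rem : List Nat) (m c : Nat)
    (rest vs : List Nat) : rest ⊆ branches K t x next rem m c rest vs := by
  induction vs with
  | nil => exact List.Subset.refl _
  | cons v vs ih =>
    rw [branches_cons]
    refine ite_cases (fun L => rest ⊆ L) (fun _ => ?_) fun _ => ih
    exact List.Subset.trans ih (hn _ _ _ _)

theorem gen_mono (K s t z : Nat) (xs : List Nat) : ∀ (rem : List Nat) (m c : Nat)
    (rest : List Nat), rest ⊆ gen K s t z xs rem m c rest := by
  induction xs with
  | nil =>
    intro rem m c rest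
    rw [gen_nil]
    split_ifs
    · exact List.subset_cons_self _ _
    · exact List.Subset.refl _
  | cons x xs ih =>
    intro rem m c rest
    rw [gen_cons]
    exact branches_mono ih _ _ _ _ _

theorem mem_gen {K s t z : Nat} {T u : Perm (Fin 8)} (ht : Rep t T) (hc : T * u = u * T)
    (hK : key u ≤ K) (hp : plausible s z (enc K u) = true) {l : List (Fin 8)}
    (hl : l.Pairwise (· < ·)) {rem : List Nat} (hrem : ∀ j ∈ l, pos (u j) ∈ rem) {m : Nat}
    (hm : m + 8 * l.countP (fun j => u j ≠ j) ≤ K) (rest : List Nat) :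
    enc K u ∈ gen K s t z (l.map pos) rem m (partialCode u l) rest := by
  induction l generalizing rem m rest with
  | nil =>
    have e : flagged K (partialCode u []) = enc K u := by
      rw [partialCode]
      simp only [List.not_mem_nil, if_false, flagged_pack]
    rw [List.map_nil, gen_nil, e, keyc_eq (rep_enc K u), if_pos ⟨hK, hp⟩]
    exact List.mem_cons_self
  | cons i l ih =>
    rw [List.pairwise_cons] at hl
    have hi : i ∉ l := fun h => lt_irrefl _ (hl.1 i h)
    rw [List.map_cons, gen_cons]
    have hvs : ∀ vs : List Nat, pos (u i) ∈ vs → enc K u ∈ branches K t (pos i)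
        (gen K s t z (l.map pos)) rem m (partialCode u (i :: l)) rest vs := by
      intro vs
      induction vs with
      | nil => exact fun h => absurd h List.not_mem_nil
      | cons v vs ihv =>
        intro h
        rw [branches_cons]
        by_cases hv : pos (u i) = v
        · subst hv
          rw [List.countP_cons] at hm
          have hm' : (if pos (u i) = pos i then m else m + 8) +
              8 * l.countP (fun j => u j ≠ j) ≤ K := by
            refine le_trans ?_ hm
            by_cases h : u i = i <;> (simp [pos_inj, h]; try omega)
          rw [if_pos ⟨prune_eq_true ht hc hl.1, le_trans (Nat.le_add_right _ _) hm'⟩,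
            partialCode_cons u hi]
          refine ih hl.2 (fun j hj => ?_) hm' _
          rw [List.mem_reverse, List.mem_filter]
          refine ⟨hrem j (List.mem_cons_of_mem _ hj), ?_⟩
          rw [decide_eq_true_iff, ne_eq, pos_inj]
          exact fun e => hi (u.injective e ▸ hj)
        · have := ihv ((List.mem_cons.1 h).resolve_left hv)
          exact ite_cases (fun L => enc K u ∈ L)
            (fun _ => gen_mono _ _ _ _ _ _ _ _ _ this) fun _ => this
    exact hvs rem (hrem i List.mem_cons_self)

theorem mapConj_eq (s : Nat) (L : List Nat) (k : List Nat → Nat) :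
    mapConj s L k = k (L.map (conjc s)).reverse := by
  have h : ∀ acc : List Nat, @List.rec Nat (fun _ => List Nat → Nat) (fun acc => k acc)
      (fun u _ ih acc => force (conjc s u) (fun v => ih (v :: acc))) L acc =
      k ((L.map (conjc s)).reverse ++ acc) := by
    induction L with
    | nil => exact fun acc => rfl
    | cons u L ih =>
      intro acc
      dsimp only
      rw [force_eq, ih]
      simp
  rw [mapConj, h, List.append_nil]

theorem dedup_eq (L : List Nat) :
    ∃ L' : List Nat, L'.Nodup ∧ (∀ u, u ∈ L' ↔ u ∈ L) ∧ ∀ k, dedup L k = k L' := by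
  have h : ∀ acc : List Nat, acc.Nodup → ∃ L' : List Nat, L'.Nodup ∧
      (∀ u, u ∈ L' ↔ u ∈ L ∨ u ∈ acc) ∧
      ∀ k : List Nat → Nat, @List.rec Nat (fun _ => List Nat → Nat) (fun acc => k acc)
        (fun u _ ih acc => bite (anyL (fun v => Nat.beq u v) acc) (ih acc) (ih (u :: acc))) L acc = k L' := by
    induction L with
    | nil => exact fun acc hacc => ⟨acc, hacc, by simp, fun k => rfl⟩
    | cons u L ih =>
      intro acc hacc
      have hu : anyL (fun v => Nat.beq u v) acc = true ↔ u ∈ acc := by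
        simp only [anyL_eq_true, beq_eq, exists_eq_right']
      by_cases h : u ∈ acc
      · obtain ⟨L', hn, hm, hk⟩ := ih acc hacc
        refine ⟨L', hn, fun v => ?_, fun k => ?_⟩
        · rw [hm, List.mem_cons]
          constructor
          · tauto
          · rintro ((rfl | h') | h') <;> tauto
        · dsimp only
          rw [bite_eq, if_pos (hu.2 h), hk]
      · obtain ⟨L', hn, hm, hk⟩ := ih (u :: acc) (List.nodup_cons.2 ⟨h, hacc⟩)
        refine ⟨L', hn, fun v => ?_, fun k => ?_⟩
        · rw [hm, List.mem_cons, List.mem_cons]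
          tauto
        · dsimp only
          rw [bite_eq, if_neg (fun e => h (hu.1 e)), hk]
  obtain ⟨L', hn, hm, hk⟩ := h [] List.nodup_nil
  exact ⟨L', hn, by simpa using hm, hk⟩

/-- Transport of a quandle structure along a permutation. -/
def conj (g : Perm (Fin 8)) (R : Fin 8 → Perm (Fin 8)) (i : Fin 8) : Perm (Fin 8) :=
  g * R (g⁻¹ i) * g⁻¹

theorem IsQ.conj {R : Fin 8 → Perm (Fin 8)} (h : IsQ R) (g : Perm (Fin 8)) :
    IsQ (conj g R) := by
  refine ⟨fun i => ?_, fun i j => ?_⟩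
  · simp [QuandleCount.conj, h.1]
  · have := h.2 (g⁻¹ i) (g⁻¹ j)
    have e : g⁻¹ ((g * R (g⁻¹ i) * g⁻¹) j) = R (g⁻¹ i) (g⁻¹ j) := by
      simp [Perm.mul_apply]
    simp only [QuandleCount.conj, e]
    calc _ = g * (R (R (g⁻¹ i) (g⁻¹ j)) * R (g⁻¹ i)) * g⁻¹ := by group
      _ = _ := by rw [this]; group

theorem Ext.conj {K : Nat} {σ : Perm (Fin 8)} {R : Fin 8 → Perm (Fin 8)}
    (hR : Ext K [(0, σ)] R) {g : Perm (Fin 8)} (hg : g 0 = 0) :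
    Ext K [(0, g * σ * g⁻¹)] (conj g R) := by
  refine ⟨hR.1.conj g, fun i => ?_, ?_⟩
  · rw [QuandleCount.conj, key_conj]
    exact hR.2.1 _
  · simp only [List.forall_mem_cons]
    refine ⟨?_, fun _ h => absurd h List.not_mem_nil⟩
    have h0 : R 0 = σ := hR.2.2 (0, σ) List.mem_cons_self
    rw [QuandleCount.conj, Perm.inv_eq_iff_eq.2 hg.symm, h0]

theorem eight_mul_moved_le_key (u : Perm (Fin 8)) :
    8 * (List.finRange 8).countP (fun i => u i ≠ i) ≤ key u := by
  rw [key, ← List.sum_ofFn, List.ofFn_eq_map]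
  induction List.finRange 8 with
  | nil => simp
  | cons i L ih =>
    rw [List.countP_cons, List.map_cons, List.sum_cons]
    by_cases h : u i = i
    · simpa [h] using ih
    · rw [if_pos (by simpa using h), if_neg h]
      split_ifs <;> omega

theorem partialCode_start {u : Perm (Fin 8)} {z : Fin 8} (h : u z = z) :
    partialCode u ((List.finRange 8).filter (· ≠ z)) = Nat.shiftLeft (pos z) (pos z) := by
  rw [partialCode, pack, Nat.zero_shiftLeft, add_zero, Finset.sum_eq_single z]
  · rw [if_neg (by simp), h, shiftLeft_eq]
  · intro i _ hi
    rw [if_pos (by simpa using hi), Nat.zero_shiftLeft]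
  · exact fun h => absurd (Finset.mem_univ z) h

theorem points_filter (z : Fin 8) : points.filter (fun t => bite (Nat.beq t (pos z)) false true) =
    ((List.finRange 8).filter (· ≠ z)).map pos := by
  rw [points_eq, List.filter_map]
  congr 2
  funext t
  rw [Function.comp_apply, bite_eq, Bool.eq_iff_iff, decide_eq_true_iff, ne_eq, ← pos_inj,
    ← beq_eq]
  cases Nat.beq (pos t) (pos z) <;> simp

theorem mkDom_eq {K : Nat} {σ : Perm (Fin 8)} (h : Nat) {z y : Fin 8} {L : List Nat}
    (hL : ∀ R, Ext K [(0, σ)] R → enc K (R y) ∈ L) :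
    ∃ L' : List Nat, (∀ R, Ext K [(0, σ)] R → enc K (R z) ∈ L') ∧
      ∀ k, mkDom K (enc K σ) (pos z) h (pos y) L k = k L' := by
  by_cases hh : (app h (pos y) = pos z ∧ isItem 1000 0 h = true) ∧
      eqc h (enc K σ) (enc K σ) h = true
  · refine ⟨(L.map (conjc h)).reverse, fun R hR => ?_, fun k => ?_⟩
    · obtain ⟨⟨hz, hi⟩, hc⟩ := hh
      obtain ⟨g, hg, -, rfl⟩ := exists_of_isItem (z := 0) hi
      have hr := rep_enc 1000 g
      rw [hr, pos_inj] at hz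
      rw [eqc_eq_true hr (rep_enc _ _) (rep_enc _ _) hr] at hc
      have hg' : g⁻¹ 0 = 0 := Perm.inv_eq_iff_eq.2 hg.symm
      have hE := hR.conj hg'
      rw [inv_inv, mul_assoc, ← hc, inv_mul_cancel_left] at hE
      rw [List.mem_reverse, List.mem_map]
      refine ⟨_, hL _ hE, ?_⟩
      rw [conjc_enc hr, conj, inv_inv, hz, ← mul_assoc, ← mul_assoc, mul_inv_cancel, one_mul,
        mul_inv_cancel_right]
    · rw [mkDom, bite_eq, if_pos, mapConj_eq]
      simpa only [band_eq, Bool.and_eq_true, beq_eq, and_assoc] using hh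
  · obtain ⟨t, j, ht, hz, hk⟩ := stab_eq (α := Nat) (rep_enc K σ) 7 z (m := 1)
      (by rw [pow_one]; exact rep_enc K σ)
    refine ⟨gen K (enc K σ) t (pos z) (((List.finRange 8).filter (· ≠ z)).map pos)
      (((List.finRange 8).filter (· ≠ z)).map pos).reverse 0 (Nat.shiftLeft (pos z) (pos z)) [],
      fun R hR => ?_, fun k => ?_⟩
    · have hRz : R z z = z := hR.1.1 z
      rw [← partialCode_start hRz]
      refine mem_gen ht (hR.pow_comm hz) (hR.2.1 z) (plausible_eq_true hR z)
        ((List.pairwise_lt_finRange 8).filter _) (fun i hi => ?_) ?_ _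
      · rw [List.mem_reverse]
        refine List.mem_map_of_mem ?_
        simp only [List.mem_filter, List.mem_finRange, true_and, decide_eq_true_iff] at hi ⊢
        exact fun e => hi ((R z).injective (e.trans hRz.symm))
      · rw [zero_add]
        exact le_trans (Nat.mul_le_mul_left _ List.filter_sublist.countP_le)
          (le_trans (eight_mul_moved_le_key _) (hR.2.1 z))
    · rw [mkDom, bite_eq, if_neg, filt_eq, hk, points_filter, List.reverse_reverse]
      simpa only [band_eq, Bool.and_eq_true, beq_eq, and_assoc] using hh

theorem exists_map_enc {K : Nat} {L : List Nat} (h : ∀ c ∈ L, ∃ p, c = enc K p) :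
    ∃ L' : List (Perm (Fin 8)), L = L'.map (enc K) := by
  induction L with
  | nil => exact ⟨[], rfl⟩
  | cons c L ih =>
    simp only [List.forall_mem_cons] at h
    obtain ⟨⟨p, rfl⟩, h⟩ := h
    obtain ⟨L', rfl⟩ := ih h
    exact ⟨p :: L', rfl⟩

theorem good_pair {K : Nat} {σ u : Perm (Fin 8)} {z : Fin 8} (hσ : σ 0 = 0) (hk : key σ ≤ K)
    (hz : z ≠ 0) (hu : u z = z) (hku : key u ≤ K) (h : Compat [] 0 σ z u) :
    Good K [(z, u), (0, σ)] := by
  have h1 : ∀ (y : Fin 8) (w : Perm (Fin 8)), w y = y → key w ≤ K → Good K [(y, w)] := by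
    intro y w hy hw
    refine ⟨List.nodup_singleton _, ?_, ?_⟩
    · simp only [List.mem_singleton, forall_eq]
      exact ⟨hy, hw⟩
    · simp only [List.mem_singleton, forall_eq, implies_true]
  exact (h1 0 σ hσ hk).extend (h1 z u hu hku) hz h

theorem doms_eq {K : Nat} {σ : Perm (Fin 8)} (hσ : σ 0 = 0) (hk : key σ ≤ K)
    (zs : List (Fin 8 × Nat)) (hz : ∀ z ∈ zs, z.1 ≠ 0) {y : Fin 8} {L : List Nat}
    (hL : ∀ R, Ext K [(0, σ)] R → enc K (R y) ∈ L) :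
    ∃ D : List (Fin 8 × List (Perm (Fin 8))), D.map Prod.fst = zs.map Prod.fst ∧
      (∀ d ∈ D, d.2.Nodup) ∧ (∀ d ∈ D, ∀ u ∈ d.2, Good K [(d.1, u), (0, σ)]) ∧
      (∀ d ∈ D, ∀ R, Ext K [(0, σ)] R → R d.1 ∈ d.2) ∧
      ∀ k, doms K (enc K σ) (zs.map fun z => (pos z.1, z.2)) (pos y) L k =
        k (D.map (encDom K)) := by
  induction zs generalizing y L with
  | nil => exact ⟨[], rfl, by simp, by simp, by simp, fun k => rfl⟩
  | cons z zs ih =>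
    obtain ⟨z, h⟩ := z
    simp only [List.forall_mem_cons] at hz
    obtain ⟨L₁, hm, h₁⟩ := mkDom_eq h (z := z) hL
    have hp : ∀ c, c ∈ (L₁.filter (fun c => band (isItem K (pos z) c)
        (okE [] 0 (enc K σ) (pos z) c))).reverse ↔
        c ∈ L₁ ∧ ∃ u, c = enc K u ∧ u z = z ∧ key u ≤ K ∧ Compat [] 0 σ z u := by
      intro c
      have hok : ∀ u, okE [] 0 (enc K σ) (pos z) (enc K u) = true ↔ Compat [] 0 σ z u := by
        intro u
        have := okE_eq_true (K := K) (A := []) (z := 0) (w := σ) (y := z) (u := u)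
        rwa [List.map_nil, pos_zero] at this
      rw [List.mem_reverse, List.mem_filter, band_eq, Bool.and_eq_true]
      refine and_congr_right fun _ => ⟨fun ⟨h1, h2⟩ => ?_, ?_⟩
      · obtain ⟨u, hu, hku, rfl⟩ := exists_of_isItem h1
        exact ⟨u, rfl, hu, hku, (hok u).1 h2⟩
      · rintro ⟨u, rfl, hu, hku, h2⟩
        exact ⟨isItem_enc hu hku, (hok u).2 h2⟩
    obtain ⟨L₂, hn, hm₂, h₂⟩ := dedup_eq (L₁.filter (fun c => band (isItem K (pos z) c)
        (okE [] 0 (enc K σ) (pos z) c))).reverse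
    simp only [hp] at hm₂
    obtain ⟨L₃, rfl⟩ := exists_map_enc (K := K) (L := L₂) fun c hc => by
      obtain ⟨-, u, rfl, -⟩ := (hm₂ c).1 hc
      exact ⟨u, rfl⟩
    have hmem : ∀ u, u ∈ L₃ ↔ enc K u ∈ L₁ ∧ u z = z ∧ key u ≤ K ∧ Compat [] 0 σ z u := by
      intro u
      rw [← List.mem_map_of_injective (enc_injective K), hm₂]
      simp only [(enc_injective K).eq_iff, exists_eq_left']
    have hR : ∀ R, Ext K [(0, σ)] R → R z ∈ L₃ := fun R hR =>
      (hmem _).2 ⟨hm R hR, hR.1.1 z, hR.2.1 z, hR.compat z⟩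
    obtain ⟨D, hD, hnd, hg, hc, hk'⟩ := ih hz.2 (y := z) (L := L₃.map (enc K))
      fun R h => List.mem_map_of_mem (hR R h)
    refine ⟨(z, L₃) :: D, by simp [hD], ?_, ?_, ?_, fun k => ?_⟩
    · simp only [List.forall_mem_cons]
      exact ⟨hn.of_map _, hnd⟩
    · simp only [List.forall_mem_cons]
      refine ⟨fun u hu => ?_, hg⟩
      obtain ⟨-, h1, h2, h3⟩ := (hmem u).1 hu
      exact good_pair hσ hk hz.1 h1 h2 h3
    · simp only [List.forall_mem_cons]
      exact ⟨hR, hc⟩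
    · have e : doms K (enc K σ) (((z, h) :: zs).map fun z => (pos z.1, z.2)) (pos y) L k =
        mkDom K (enc K σ) (pos z) h (pos y) L (fun L =>
          filt (fun c => band (isItem K (pos z) c) (okE [] 0 (enc K σ) (pos z) c)) L (fun L =>
            dedup L (fun L => doms K (enc K σ) (zs.map fun z => (pos z.1, z.2)) (pos z) L
              (fun D => k ((pos z, L) :: D))))) := rfl
      rw [e, h₁, filt_eq, h₂, hk']
      rfl

theorem run_eq {c : Nat} {σ : Perm (Fin 8)} (hσ : σ 0 = 0) (hc : Rep c σ)
    (hs : sumL (fun x => Nat.shiftLeft (app c x) x) points = c) (zs : List (Fin 8 × Nat))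
    (hz : zs.map Prod.fst = [1, 2, 3, 4, 5, 6, 7]) :
    run c (zs.map fun z => (pos z.1, z.2)) = wt (key σ) [(0, σ)] := by
  have hf : flagged (key σ) c = enc (key σ) σ := by
    rw [← flagged_pack, ← sum_digits hc, hs]
  rw [run, force_eq, force_eq, keyc_eq hc, hf]
  have hz0 : ∀ z ∈ zs, z.1 ≠ 0 := by
    intro z hzm h0
    have := List.mem_map_of_mem (f := Prod.fst) hzm
    rw [hz, h0] at this
    exact absurd this (by decide)
  obtain ⟨D, hD, hn, hg, hcm, hk⟩ := doms_eq hσ le_rfl zs hz0 (y := 0)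
    (L := [enc (key σ) σ]) fun R hR => by
      rw [hR.2.2 (0, σ) List.mem_cons_self]
      exact List.mem_cons_self
  rw [hz] at hD
  rw [pos_zero] at hk
  rw [hk, ← search_eq 7 (A := [(0, σ)]) (D := D)]
  · simp [encItem, pos_zero]
  · rw [← List.length_map (f := Prod.fst), hD]
    rfl
  · refine ⟨?_, by rw [hD]; decide, ?_, hn, hg, hcm⟩
    · refine ⟨List.nodup_singleton _, ?_, ?_⟩
      · simp only [List.mem_singleton, forall_eq]
        exact ⟨hσ, le_rfl⟩
      · simp only [List.mem_singleton, forall_eq, implies_true]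
    · rw [hD]
      simp only [List.map_cons, List.map_nil]
      decide

/-- Quandle operations correspond to their families of right translations. -/
noncomputable def translations :
    {op : Fin 8 → Fin 8 → Fin 8 // IsQuandleOp op} ≃ {R : Fin 8 → Perm (Fin 8) // IsQ R} where
  toFun op := ⟨fun y => Equiv.ofBijective (fun x => op.1 x y)
    (Function.bijective_iff_existsUnique _ |>.2 fun x => by
      simpa only [eq_comm] using op.2.2.1 x y),
    fun i => op.2.1 i, fun i j => Equiv.ext fun x => (op.2.2.2 x j i).symm⟩
  invFun R := ⟨fun x y => R.1 y x, R.2.1, fun x y =>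
    ⟨(R.1 y).symm x, by simp, fun z hz => by simp [hz]⟩,
    fun x y z => (congrArg (· x) (R.2.2 z y)).symm⟩
  left_inv op := rfl
  right_inv R := Subtype.ext (funext fun y => Equiv.ext fun x => rfl)

open Classical in
/-- The share of the point `j` in a quandle structure, equally divided between the points of
maximal key. -/
noncomputable def share (R : Fin 8 → Perm (Fin 8)) (j : Fin 8) : Nat :=
  if ∀ i, key (R i) ≤ key (R j) then 840 / Finset.card {i | key (R i) = key (R j)} else 0

theorem sum_share (R : Fin 8 → Perm (Fin 8)) : ∑ j, share R j = 840 := by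
  classical
  obtain ⟨m, hm⟩ := Finite.exists_max fun i => key (R i)
  have hs : ∀ j, share R j = if key (R j) = key (R m) then
      840 / Finset.card {i | key (R i) = key (R m)} else 0 := by
    intro j
    rw [share]
    by_cases h : key (R j) = key (R m)
    · rw [if_pos h, if_pos (by rwa [h]), h]
    · rw [if_neg h, if_neg fun e => h (le_antisymm (hm j) (e m))]
  have h1 : 0 < Finset.card {i | key (R i) = key (R m)} :=
    Finset.card_pos.2 ⟨m, by simp⟩
  have h8 : Finset.card {i | key (R i) = key (R m)} ≤ 8 := Finset.card_le_univ _
  rw [Finset.sum_congr rfl fun j _ => hs j, ← Finset.sum_filter, Finset.sum_const, smul_eq_mul]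
  refine Nat.mul_div_cancel' ?_
  revert h1 h8
  generalize Finset.card {i | key (R i) = key (R m)} = n
  intro h1 h8
  interval_cases n <;> decide

theorem share_conj (g : Perm (Fin 8)) (R : Fin 8 → Perm (Fin 8)) (j : Fin 8) :
    share (conj g R) (g j) = share R j := by
  classical
  have hk : ∀ i, key (conj g R (g i)) = key (R i) := fun i => by
    rw [conj, key_conj]
    simp
  have ha : (∀ i, key (conj g R i) ≤ key (R j)) ↔ ∀ i, key (R i) ≤ key (R j) := by
    rw [← g.forall_congr_right]
    simp only [hk]
  simp only [share, hk, ha]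
  congr 2
  refine Finset.card_bij' (fun i _ => g⁻¹ i) (fun i _ => g i) ?_ ?_ ?_ ?_
  · simp only [Finset.mem_filter, Finset.mem_univ, true_and]
    intro i hi
    rw [← hk, ← hi]
    simp
  · simp [hk]
  · simp
  · simp

theorem conj_conj_inv (g : Perm (Fin 8)) (R : Fin 8 → Perm (Fin 8)) :
    conj g (conj g⁻¹ R) = R := by
  funext i
  have e : g (g⁻¹ i) = i := by simp
  simp only [conj, inv_inv, e]
  group

open Classical in
theorem sum_conj (g : Perm (Fin 8)) (F : (Fin 8 → Perm (Fin 8)) → Nat) :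
    ∑ R with IsQ R, F (conj g R) = ∑ R with IsQ R, F R := by
  refine Finset.sum_bij' (fun R _ => conj g R) (fun R _ => conj g⁻¹ R) ?_ ?_ ?_ ?_ ?_
  · simpa only [Finset.mem_filter, Finset.mem_univ, true_and] using fun R h => h.conj g
  · simpa only [Finset.mem_filter, Finset.mem_univ, true_and] using fun R h => h.conj g⁻¹
  · intro R _
    have := conj_conj_inv g⁻¹ R
    rwa [inv_inv] at this
  · exact fun R _ => conj_conj_inv g R
  · exact fun R _ => rfl

open Classical in
theorem card_quandleOp : Nat.card {op : Fin 8 → Fin 8 → Fin 8 // IsQuandleOp op} =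
    Finset.card {R | IsQ R} := by
  rw [Nat.card_congr translations, Nat.subtype_card]
  exact fun R => by rw [Finset.mem_filter, and_iff_right (Finset.mem_univ R)]

open Classical in
theorem sum_sum_share :
    ∑ R with IsQ R, ∑ j, share R j = Finset.card {R | IsQ R} * 840 :=
  Finset.sum_const_nat fun R _ => sum_share R

open Classical in
theorem sum_share_eq (j : Fin 8) :
    ∑ R with IsQ R, share R j = ∑ R with IsQ R, share R 0 := by
  rw [← sum_conj (swap 0 j)]
  refine Finset.sum_congr rfl fun R _ => ?_
  have := share_conj (swap 0 j) R 0
  rwa [swap_apply_left] at this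

open Classical in
theorem sum_comm_share :
    ∑ R with IsQ R, ∑ j, share R j = ∑ _j : Fin 8, ∑ R with IsQ R, share R 0 :=
  Finset.sum_comm.trans (Finset.sum_congr rfl fun j _ => sum_share_eq j)

theorem sum_const_fin_eight (n : Nat) : ∑ _j : Fin 8, n = 8 * n := by
  rw [Finset.sum_const, Finset.card_univ, Fintype.card_fin, smul_eq_mul]

open Classical in
theorem card_mul_eq : Nat.card {op : Fin 8 → Fin 8 → Fin 8 // IsQuandleOp op} * 840 =
    8 * ∑ R with IsQ R, share R 0 :=
  (congrArg (· * 840) card_quandleOp).trans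
    (sum_sum_share.symm.trans (sum_comm_share.trans (sum_const_fin_eight _)))

/-- Extend a permutation of seven points by the fixed point `0`. -/
def lift (e : Perm (Fin 7)) : Perm (Fin 8) := Perm.decomposeFin.symm (0, e)

theorem lift_zero (e : Perm (Fin 7)) : lift e 0 = 0 := by
  rw [lift, Perm.decomposeFin_symm_apply_zero]

theorem lift_succ (e : Perm (Fin 7)) (i : Fin 7) : lift e i.succ = (e i).succ := by
  rw [lift, Perm.decomposeFin_symm_apply_succ, swap_self, Equiv.refl_apply]

theorem lift_mul (e f : Perm (Fin 7)) : lift (e * f) = lift e * lift f := by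
  refine Equiv.ext fun i => Fin.cases ?_ (fun i => ?_) i
  · simp only [Perm.mul_apply, lift_zero]
  · simp only [Perm.mul_apply, lift_succ]

theorem lift_inv (e : Perm (Fin 7)) : lift e⁻¹ = (lift e)⁻¹ := by
  rw [eq_inv_iff_mul_eq_one, ← lift_mul, inv_mul_cancel]
  refine Equiv.ext fun i => Fin.cases ?_ (fun i => ?_) i
  · rw [lift_zero]; rfl
  · rw [lift_succ]; rfl

theorem lift_injective : Function.Injective lift := fun e f h => by
  have := Perm.decomposeFin.symm.injective h
  exact (Prod.mk.inj this).2

theorem exists_lift {p : Perm (Fin 8)} (h : p 0 = 0) : ∃ e, lift e = p := by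
  obtain ⟨⟨i, e⟩, rfl⟩ := Perm.decomposeFin.symm.surjective p
  rw [Perm.decomposeFin_symm_apply_zero] at h
  exact ⟨e, by rw [h, lift]⟩

/-- The total share of the point `0` in the quandles where its translation is given by `e`. -/
noncomputable def classWt (e : Perm (Fin 7)) : Nat := wt (key (lift e)) [(0, lift e)]

open Classical in
theorem classWt_eq_sum (e : Perm (Fin 7)) :
    classWt e = ∑ R with IsQ R ∧ R 0 = lift e, share R 0 := by
  rw [classWt, wt]
  simp only [share]
  rw [← Finset.sum_filter, Finset.filter_filter]
  refine Finset.sum_congr (Finset.filter_congr fun R _ => ?_) ?_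
  · simp only [Ext, List.forall_mem_cons]
    constructor
    · rintro ⟨h1, h2, h3, -⟩
      exact ⟨⟨h1, h3⟩, h3 ▸ h2⟩
    · rintro ⟨⟨h1, h3⟩, h2⟩
      exact ⟨h1, h3 ▸ h2, h3, fun _ h => absurd h List.not_mem_nil⟩
  · simp only [Finset.mem_filter]
    exact fun R hR => by rw [hR.2.1.2]

open Classical in
theorem sum_classWt : ∑ R with IsQ R, share R 0 = ∑ e, classWt e := by
  simp only [classWt_eq_sum, Finset.sum_filter]
  rw [Finset.sum_comm]
  refine Finset.sum_congr rfl fun R _ => ?_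
  by_cases h : IsQ R
  · obtain ⟨e, he⟩ := exists_lift (h.1 0)
    simp only [h, true_and, if_true, ← he, lift_injective.eq_iff, Finset.sum_ite_eq,
      Finset.mem_univ]
  · simp only [h, false_and, if_false, Finset.sum_const_zero]

theorem classWt_conj (g e : Perm (Fin 7)) : classWt (g * e * g⁻¹) = classWt e := by
  classical
  rw [classWt_eq_sum, classWt_eq_sum, ← Finset.filter_filter, ← Finset.filter_filter,
    Finset.sum_filter, Finset.sum_filter _ (fun R => share R 0), ← sum_conj (lift g)]
  refine Finset.sum_congr rfl fun R _ => ?_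
  have h0 : conj (lift g) R 0 = lift g * R 0 * (lift g)⁻¹ := by
    rw [conj, ← lift_inv, lift_zero]
  have hs : share (conj (lift g) R) 0 = share R 0 := by
    have := share_conj (lift g) R 0
    rwa [lift_zero] at this
  rw [hs, h0, lift_mul, lift_mul, lift_inv]
  simp only [mul_left_inj, mul_right_inj]

/-- The product of the given cycles. -/
def cycles (L : List (List (Fin 7))) : Perm (Fin 7) := (L.map List.formPerm).prod

theorem cycleType_cycles {L : List (List (Fin 7))} (hL : L.flatten.Nodup)
    (h2 : ∀ l ∈ L, 2 ≤ l.length) : (cycles L).cycleType = (L.map List.length : Multiset ℕ) := by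
  rw [List.nodup_flatten] at hL
  have hc : (L.map List.formPerm).map (Finset.card ∘ Perm.support) = L.map List.length := by
    rw [List.map_map]
    refine List.map_congr_left fun l hl => ?_
    have h1 : ∀ x, l ≠ [x] := by
      rintro x rfl
      exact absurd (h2 _ hl) (by simp)
    rw [Function.comp_apply, Function.comp_apply,
      List.support_formPerm_of_nodup l (hL.1 l hl) h1, List.toFinset_card_of_nodup (hL.1 l hl)]
  rw [cycles, Perm.cycleType_eq (L.map List.formPerm) rfl, hc]
  · simp only [List.forall_mem_map]
    exact fun l hl => List.isCycle_formPerm (hL.1 l hl) (h2 l hl)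
  · rw [List.pairwise_map]
    refine hL.2.imp_of_mem fun {a b} ha hb h => ?_
    exact (List.formPerm_disjoint_iff (hL.1 a ha) (hL.1 b hb) (h2 a ha) (h2 b hb)).2 h

/-- The number of permutations of `Fin 7` of cycle type `m`. -/
def classSize (m : Multiset ℕ) : ℕ := Finset.card {g : Perm (Fin 7) | g.cycleType = m}

theorem sum_class_function {G : Perm (Fin 7) → Nat} (hG : ∀ g e, G (g * e * g⁻¹) = G e)
    {T : List (Perm (Fin 7))} (hT : (T.map Perm.cycleType).Nodup)
    (hc : (T.map fun e => classSize e.cycleType).sum = 5040) :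
    ∑ e, G e = (List.zipWith (· * ·) (T.map fun e => classSize e.cycleType) (T.map G)).sum := by
  have hu : ∀ g : Perm (Fin 7), g.cycleType ∈ (T.map Perm.cycleType).toFinset := by
    have h : (Finset.univ.filter fun g : Perm (Fin 7) =>
        g.cycleType ∈ (T.map Perm.cycleType).toFinset).card = 5040 := by
      rw [Finset.card_eq_sum_card_fiberwise (f := Perm.cycleType)
        (t := (T.map Perm.cycleType).toFinset), List.sum_toFinset _ hT, List.map_map, ← hc]
      · refine congrArg List.sum (List.map_congr_left fun e he => ?_)
        rw [Function.comp_apply, Finset.filter_filter]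
        congr 1
        refine Finset.filter_congr fun g _ => and_iff_right_of_imp fun h => ?_
        rw [h, List.mem_toFinset]
        exact List.mem_map_of_mem he
      · exact fun g hg => (Finset.mem_filter.1 hg).2
    refine fun g => Finset.card_filter_eq_iff.1 (h.trans ?_) g (Finset.mem_univ g)
    rw [Finset.card_univ, Fintype.card_perm, Fintype.card_fin]
    rfl
  rw [← Finset.sum_fiberwise_of_maps_to (g := Perm.cycleType) fun g _ => hu g,
    List.sum_toFinset _ hT, List.map_map, List.zipWith_map, List.zipWith_self]
  refine congrArg List.sum (List.map_congr_left fun e _ => ?_)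
  rw [Function.comp_apply, classSize, ← smul_eq_mul, ← Finset.sum_const]
  refine Finset.sum_congr rfl fun g hg => ?_
  obtain ⟨c, rfl⟩ := isConj_iff.1 (Perm.isConj_iff_cycleType_eq.2 (Finset.mem_filter.1 hg).2)
  exact (hG c g).symm

theorem classWt_eq {e : Perm (Fin 7)} (c h₁ h₂ h₃ h₄ h₅ h₆ h₇ : Nat) {W : Nat}
    (hc : ∀ i, app c (pos i) = pos (lift e i))
    (hs : sumL (fun x => Nat.shiftLeft (app c x) x) points = c)
    (hW : Nat.beq (run c [(6, h₁), (12, h₂), (18, h₃), (24, h₄), (30, h₅), (36, h₆), (42, h₇)])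
      W = true) : classWt e = W := by
  rw [beq_eq] at hW
  rw [← hW]
  exact (run_eq (lift_zero e) hc hs
    [(1, h₁), (2, h₂), (3, h₃), (4, h₄), (5, h₅), (6, h₆), (7, h₇)] rfl).symm

set_option maxRecDepth 100000 in
theorem classWt_one : classWt (cycles []) = 105 :=
  classWt_eq 187224474304896 0 187224474280704 187224472756608 187224375214464 187218132517248
    186818599895424 161248512098688 (by decide +kernel) (by decide +kernel) (by decide +kernel)

set_option maxRecDepth 100000 in
theorem classWt_two : classWt (cycles [[0, 1]]) = 655375 :=
  classWt_eq 187224474280704 0 187224474280704 0 187224375214464 187218132517248 186818599895424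
    161248512098688 (by decide +kernel) (by decide +kernel) (by decide +kernel)

set_option maxRecDepth 100000 in
theorem classWt_two_two : classWt (cycles [[0, 1], [2, 3]]) = 1398425 :=
  classWt_eq 187224375190272 0 187224474280704 187224269858304 187224375214464 0 186818599895424
    161248512098688 (by decide +kernel) (by decide +kernel) (by decide +kernel)

set_option maxRecDepth 100000 in
theorem classWt_two_two_two : classWt (cycles [[0, 1], [2, 3], [4, 5]]) = 840603 :=
  classWt_eq 186818500780800 0 187224474280704 187224269858304 187224375214464 186387061064064
    186818599895424 0 (by decide +kernel) (by decide +kernel) (by decide +kernel)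

set_option maxRecDepth 100000 in
theorem classWt_three : classWt (cycles [[0, 1, 2]]) = 421638 :=
  classWt_eq 187224471184128 0 187224471184128 187224471184128 0 187218132517248 186818599895424
    161248512098688 (by decide +kernel) (by decide +kernel) (by decide +kernel)

set_option maxRecDepth 100000 in
theorem classWt_three_two : classWt (cycles [[0, 1, 2], [3, 4]]) = 310660 :=
  classWt_eq 187218129396480 0 187224471184128 187224471184128 0 187218132517248 0
    161248512098688 (by decide +kernel) (by decide +kernel) (by decide +kernel)

set_option maxRecDepth 100000 in
theorem classWt_three_two_two : classWt (cycles [[0, 1, 2], [3, 4], [5, 6]]) = 138936 :=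
  classWt_eq 161242167190272 0 187224471184128 187224471184128 0 187218132517248 133630026891648
    161248512098688 (by decide +kernel) (by decide +kernel) (by decide +kernel)

set_option maxRecDepth 100000 in
theorem classWt_three_three : classWt (cycles [[0, 1, 2], [3, 4, 5]]) = 80310 :=
  classWt_eq 186406380577536 0 187224471184128 187224471184128 185967896053632 186406383698304
    186406383698304 0 (by decide +kernel) (by decide +kernel) (by decide +kernel)

set_option maxRecDepth 100000 in
theorem classWt_four : classWt (cycles [[0, 1, 2, 3]]) = 123270 :=
  classWt_eq 187224173912832 0 187224173912832 187224173912832 187224173912832 0 186818599895424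
    161248512098688 (by decide +kernel) (by decide +kernel) (by decide +kernel)

set_option maxRecDepth 100000 in
theorem classWt_four_two : classWt (cycles [[0, 1, 2, 3], [4, 5]]) = 65002 :=
  classWt_eq 186818299503360 0 187224173912832 187224173912832 187224173912832 0 186818599895424
    0 (by decide +kernel) (by decide +kernel) (by decide +kernel)

set_option maxRecDepth 100000 in
theorem classWt_four_three : classWt (cycles [[0, 1, 2, 3], [4, 5, 6]]) = 10626 :=
  classWt_eq 134866375090944 0 187224173912832 187224173912832 187224173912832 0 134866675483008
    134866675483008 (by decide +kernel) (by decide +kernel) (by decide +kernel)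

set_option maxRecDepth 100000 in
theorem classWt_five : classWt (cycles [[0, 1, 2, 3, 4]]) = 15960 :=
  classWt_eq 187198806762240 0 187198806762240 187198806762240 187198806762240 187198806762240 0
    161248512098688 (by decide +kernel) (by decide +kernel) (by decide +kernel)

set_option maxRecDepth 100000 in
theorem classWt_five_two : classWt (cycles [[0, 1, 2, 3, 4], [5, 6]]) = 8680 :=
  classWt_eq 161222844556032 0 187198806762240 187198806762240 187198806762240 187198806762240 0
    161248512098688 (by decide +kernel) (by decide +kernel) (by decide +kernel)

set_option maxRecDepth 100000 in
theorem classWt_six : classWt (cycles [[0, 1, 2, 3, 4, 5]]) = 4440 :=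
  classWt_eq 185169434714880 0 185169434714880 185169434714880 185169434714880 185169434714880
    185169434714880 0 (by decide +kernel) (by decide +kernel) (by decide +kernel)

set_option maxRecDepth 100000 in
theorem classWt_seven : classWt (cycles [[0, 1, 2, 3, 4, 5, 6]]) = 1050 :=
  classWt_eq 29313661477632 0 29313661477632 29313661477632 29313661477632 29313661477632
    29313661477632 29313661477632 (by decide +kernel) (by decide +kernel) (by decide +kernel)

/-- One permutation for every cycle type of `Fin 7`, as a list of cycles. -/
def cycleTypes : List (List (List (Fin 7))) :=
  [[], [[0, 1]], [[0, 1], [2, 3]], [[0, 1], [2, 3], [4, 5]], [[0, 1, 2]], [[0, 1, 2], [3, 4]],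
   [[0, 1, 2], [3, 4], [5, 6]], [[0, 1, 2], [3, 4, 5]], [[0, 1, 2, 3]], [[0, 1, 2, 3], [4, 5]],
   [[0, 1, 2, 3], [4, 5, 6]], [[0, 1, 2, 3, 4]], [[0, 1, 2, 3, 4], [5, 6]], [[0, 1, 2, 3, 4, 5]],
   [[0, 1, 2, 3, 4, 5, 6]]]

theorem map_cycleType : (cycleTypes.map cycles).map Perm.cycleType =
    cycleTypes.map fun L => (L.map List.length : Multiset ℕ) := by
  have h : ∀ L ∈ cycleTypes, L.flatten.Nodup ∧ ∀ l ∈ L, 2 ≤ l.length := by decide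
  rw [List.map_map]
  exact List.map_congr_left fun L hL => cycleType_cycles (h L hL).1 (h L hL).2

theorem map_classSize : (cycleTypes.map fun L => classSize (L.map List.length : Multiset ℕ)) =
    [1, 21, 105, 105, 70, 420, 210, 280, 210, 630, 420, 504, 504, 840, 720] := by
  simp only [classSize, Perm.card_of_cycleType]
  decide

theorem map_classWt : (cycleTypes.map cycles).map classWt =
    [105, 655375, 1398425, 840603, 421638, 310660, 138936, 80310, 123270, 65002, 10626, 15960,
      8680, 4440, 1050] := by
  simp only [cycleTypes, List.map_cons, List.map_nil, classWt_one, classWt_two, classWt_two_two,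
    classWt_two_two_two, classWt_three, classWt_three_two, classWt_three_two_two,
    classWt_three_three, classWt_four, classWt_four_two, classWt_four_three, classWt_five,
    classWt_five_two, classWt_six, classWt_seven]

theorem sum_classWt_eq : ∑ e, classWt e = 548721180 := by
  have hs : (cycleTypes.map cycles).map (fun e => classSize e.cycleType) =
      [1, 21, 105, 105, 70, 420, 210, 280, 210, 630, 420, 504, 504, 840, 720] := by
    have h := congrArg (List.map classSize) map_cycleType
    simp only [List.map_map] at h ⊢
    exact h.trans map_classSize
  rw [sum_class_function classWt_conj (T := cycleTypes.map cycles), map_classWt, hs]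
  · simp only [List.zipWith_cons_cons, List.zipWith_nil_right, List.sum_cons, List.sum_nil,
      Nat.reduceMul, Nat.reduceAdd]
  · rw [map_cycleType]
    decide
  · rw [hs]
    rfl

end QuandleCount

/-- There are exactly 5225916 quandle structures on a 8-element set. -/
theorem card_quandles_order_eight :
    Nat.card {op : Fin 8 → Fin 8 → Fin 8 // IsQuandleOp op} = 5225916 :=
  Nat.eq_of_mul_eq_mul_right (Nat.succ_pos 839)
    (QuandleCount.card_mul_eq.trans
      (congrArg (8 * ·) (QuandleCount.sum_classWt.trans QuandleCount.sum_classWt_eq)))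
end
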